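/- For every integer v ≥ 10 with v ≡ 1 (mod 3), there exists a super-simple 2-(v,4,1) directed design (which necessarily has v(v−1)/6 blocks) whose smallest defining sets contain at least half of the blocks, i.e. at least v(v−1)/12 blocks. -/

import Mathlib

open scoped Classical

/-- A block of size `k` on the point set `α`: a list of `k` distinct points. -/
def IsBlock {α : Type*} (k : ℕ) (b : List α) : Prop :=
  b.Nodup ∧ b.length = k

/-- A `t-(v,k,λ)` directed design whose point set is the whole (finite) type `α`
(so `v = Fintype.card α`): every ordered `t`-tuple of distinct points appears,
as a subsequence, in exactly `lam` blocks of the multiset `B`. -/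
def IsDD {α : Type*} (t k lam : ℕ) (B : Multiset (List α)) : Prop :=
  (∀ b ∈ B, IsBlock k b) ∧
    ∀ s : List α, s.Nodup → s.length = t →
      B.countP (fun b => s.Sublist b) = lam

/-- `S` is a defining set of the `t-(v,k,λ)` directed design with block multiset `B`:
`S` is a sub-multiset of `B`, and `B` is the unique block multiset of a
`t-(v,k,λ)DD` on the same point set containing `S`. -/
def IsDefiningSet {α : Type*} (t k lam : ℕ) (B S : Multiset (List α)) : Prop :=
  S ≤ B ∧ ∀ B' : Multiset (List α), IsDD t k lam B' → S ≤ B' → B' = B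

/-- A `(v,k,t)` directed trade `T₁ - T₂` of volume `s` on the point set `α`. -/
def IsTrade {α : Type*} (t k s : ℕ) (T₁ T₂ : Multiset (List α)) : Prop :=
  1 ≤ s ∧ Multiset.card T₁ = s ∧ Multiset.card T₂ = s ∧
    (∀ b ∈ T₁, IsBlock k b) ∧ (∀ b ∈ T₂, IsBlock k b) ∧
    (∀ b, b ∈ T₁ → b ∉ T₂) ∧
    ∀ l : List α, l.Nodup → l.length = t →
      T₁.countP (fun b => l.Sublist b) = T₂.countP (fun b => l.Sublist b)

/-- A multiset of blocks is super-simple if any two blocks (any sub-multiset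
consisting of two blocks) intersect, as point sets, in at most two points. -/
def SuperSimple {α : Type*} (B : Multiset (List α)) : Prop :=
  ∀ b₁ b₂ : List α, ({b₁, b₂} : Multiset (List α)) ≤ B →
    (b₁.toFinset ∩ b₂.toFinset).card ≤ 2

/-- A `2-(v,K,1)` design (pairwise balanced design) on the point type `β`. -/
def IsPBD {β : Type*} (K : Set ℕ) (D : Multiset (Finset β)) : Prop :=
  (∀ b ∈ D, b.card ∈ K) ∧
    ∀ x y : β, x ≠ y → D.countP (fun b => x ∈ b ∧ y ∈ b) = 1

/-- A `{K}`-GDD on the point type `β` with group multiset `Gs` and block multiset `Bs`. -/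
def IsGDD {β : Type*} (K : Set ℕ) (Gs Bs : Multiset (Finset β)) : Prop :=
  (∀ x : β, Gs.countP (fun G => x ∈ G) = 1) ∧
    (∀ b ∈ Bs, b.card ∈ K) ∧
    (∀ b ∈ Bs, ∀ G ∈ Gs, (b ∩ G).card ≤ 1) ∧
    (∀ x y : β, x ≠ y → (∀ G ∈ Gs, ¬(x ∈ G ∧ y ∈ G)) →
      Bs.countP (fun b => x ∈ b ∧ y ∈ b) = 1)

/-- A `4`-DGDD on the point type `β` with group multiset `Gs` and block multiset `B`:
the groups partition the points, no block meets a group twice, and every ordered pair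
of points from distinct groups appears in exactly one block. -/
def IsDGDD {β : Type*} (Gs : Multiset (Finset β)) (B : Multiset (List β)) : Prop :=
  (∀ x : β, Gs.countP (fun G => x ∈ G) = 1) ∧
    (∀ b ∈ B, IsBlock 4 b) ∧
    (∀ b ∈ B, ∀ G ∈ Gs, (b.toFinset ∩ G).card ≤ 1) ∧
    (∀ x y : β, x ≠ y → (∀ G ∈ Gs, ¬(x ∈ G ∧ y ∈ G)) →
      B.countP (fun b => [x, y].Sublist b) = 1)

/-- `S` is a defining set of the `4`-DGDD with groups `Gs` and block multiset `B`. -/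
def IsDGDDDefiningSet {β : Type*} (Gs : Multiset (Finset β)) (B S : Multiset (List β)) : Prop :=
  S ≤ B ∧ ∀ B' : Multiset (List β), IsDGDD Gs B' → S ≤ B' → B' = B

open scoped List

/-- The ordered pairs `(x, y)` such that `x` occurs before `y` in the list. -/
def orderedPairs {α : Type*} : List α → List (α × α)
  | [] => []
  | a :: l => l.map (fun b => (a, b)) ++ orderedPairs l

/-- The pairs of consecutive entries of a list. -/
def consecutivePairs {α : Type*} : List α → List (α × α)
  | [] => []
  | [_] => []
  | a :: b :: l => (a, b) :: consecutivePairs (b :: l)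

/-- Two blocks are swappable if some pair of points is consecutive in both of them,
in opposite orders. Exchanging these two points in both blocks is a trade of volume two. -/
def Swappable {α : Type*} (b c : List α) : Prop :=
  ∃ x y, [x, y] <:+: b ∧ [y, x] <:+: c

/-- `S` meets every pair of swappable blocks of `B`. -/
def MeetsSwaps {α : Type*} (B S : Finset (List α)) : Prop :=
  ∀ b ∈ B, ∀ c ∈ B, Swappable b c → b ∈ S ∨ c ∈ S

/-- `B` is a super-simple decomposition of the relation `R` into directed blocks of size four
in which every set of blocks meeting all swappable pairs contains at least half of the blocks. -/
structure IsHalfDecomposition {α : Type*} (R : α → α → Prop) (B : Finset (List α)) : Prop where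
  isBlock : ∀ b ∈ B, IsBlock 4 b
  rel : ∀ b ∈ B, ∀ x y, [x, y] <+ b → R x y
  exists_mem : ∀ x y, R x y → ∃ b ∈ B, [x, y] <+ b
  unique : ∀ b ∈ B, ∀ c ∈ B, ∀ x y, [x, y] <+ b → [x, y] <+ c → b = c
  superSimple : ∀ b ∈ B, ∀ c ∈ B, b ≠ c → (b.toFinset ∩ c.toFinset).card ≤ 2
  half : ∀ S ⊆ B, MeetsSwaps B S → B.card ≤ 2 * S.card

/-- The relation `R` has a super-simple decomposition into directed blocks of size four
which needs at least half of its blocks to meet all swappable pairs. -/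
def HalfDecomposable {α : Type*} (R : α → α → Prop) : Prop :=
  ∃ B : Finset (List α), IsHalfDecomposition R B

section Lists

variable {α : Type*}

theorem mem_orderedPairs {l : List α} {x y : α} : (x, y) ∈ orderedPairs l ↔ [x, y] <+ l := by
  induction l with
  | nil => simp [orderedPairs]
  | cons a l ih =>
    simp only [orderedPairs, List.mem_append, List.mem_map, Prod.mk.injEq, ih]
    constructor
    · rintro (⟨b, hb, rfl, rfl⟩ | h)
      · exact List.Sublist.cons_cons a (List.singleton_sublist.2 hb)
      · exact h.cons a
    · intro h
      cases h with
      | cons _ h => exact Or.inr h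
      | cons_cons _ h => exact Or.inl ⟨y, List.singleton_sublist.1 h, rfl, rfl⟩

theorem isInfix_of_mem_consecutivePairs {l : List α} {x y : α}
    (h : (x, y) ∈ consecutivePairs l) : [x, y] <:+: l := by
  induction l with
  | nil => simp [consecutivePairs] at h
  | cons a l ih =>
    cases l with
    | nil => simp [consecutivePairs] at h
    | cons b l =>
      simp only [consecutivePairs, List.mem_cons, Prod.mk.injEq] at h
      rcases h with ⟨rfl, rfl⟩ | h
      · exact ⟨[], l, rfl⟩
      · exact (ih h).trans (List.suffix_cons a _).isInfix

theorem nodup_of_forall_ne {l : List α} (h : ∀ x y, [x, y] <+ l → x ≠ y) : l.Nodup :=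
  List.pairwise_iff_forall_sublist.2 fun {x y} hxy => h x y hxy

theorem exists_pair_sublist {l : List α} (hl : l.Nodup) {x y : α} (hx : x ∈ l) (hy : y ∈ l)
    (hxy : x ≠ y) : [x, y] <+ l ∨ [y, x] <+ l := by
  induction l with
  | nil => simp at hx
  | cons a l ih =>
    rcases List.mem_cons.1 hx with rfl | hxl
    · rcases List.mem_cons.1 hy with rfl | hyl
      · exact absurd rfl hxy
      · exact Or.inl (List.Sublist.cons_cons _ (List.singleton_sublist.2 hyl))
    · rcases List.mem_cons.1 hy with rfl | hyl
      · exact Or.inr (List.Sublist.cons_cons _ (List.singleton_sublist.2 hxl))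
      · exact (ih hl.of_cons hxl hyl).imp (fun h => h.cons a) fun h => h.cons a

theorem exists_mem_pair {l : List α} (hl : l.length = 4) {x : α} (hx : x ∈ l) :
    ∃ y, [x, y] <+ l ∨ [y, x] <+ l := by
  match l, hl with
  | [a, b, c, d], _ =>
    simp only [← mem_orderedPairs, orderedPairs]
    simp only [List.mem_cons, List.not_mem_nil, or_false] at hx
    rcases hx with rfl | rfl | rfl | rfl
    · exact ⟨b, by simp⟩
    · exact ⟨c, by simp⟩
    · exact ⟨a, by simp⟩
    · exact ⟨a, by simp⟩

theorem length_le_countP_chain (p : α → Prop) [DecidablePred p] {r : α → α → Prop}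
    (hr : ∀ a b, r a b → p a ∨ p b) (a : α) (l : List α) (h : List.IsChain r (a :: l)) :
    l.length ≤ (a :: l).dropLast.countP p + l.countP p := by
  induction l generalizing a with
  | nil => simp
  | cons b l ih =>
    rw [List.isChain_cons_cons] at h
    have := ih b h.2
    rw [List.dropLast_cons_cons, List.countP_cons, List.countP_cons (l := l), List.length_cons]
    rcases hr a b h.1 with h' | h' <;> simp only [h', decide_true, if_true] <;> omega

theorem pair_sublist_map {β : Type*} {f : α → β} {b : List α} {p q : β}
    (h : [p, q] <+ b.map f) : ∃ x y, [x, y] <+ b ∧ f x = p ∧ f y = q := by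
  obtain ⟨l, hl, hl'⟩ := List.sublist_map_iff.1 h
  match l, hl' with
  | [x, y], hl' =>
    simp only [List.map_cons, List.map_nil, List.cons.injEq, and_true] at hl'
    exact ⟨x, y, hl, hl'.1.symm, hl'.2.symm⟩

end Lists

section Decompositions

variable {α β ι : Type*}

theorem IsHalfDecomposition.mem_left_or_right {R : α → α → Prop} {B : Finset (List α)}
    (h : IsHalfDecomposition R B) {b : List α} (hb : b ∈ B) {x : α} (hx : x ∈ b) :
    ∃ y, R x y ∨ R y x := by
  obtain ⟨y, hy⟩ := exists_mem_pair (h.isBlock b hb).2 hx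
  exact ⟨y, hy.imp (h.rel b hb x y) (h.rel b hb y x)⟩

theorem IsHalfDecomposition.exists_rel {R : α → α → Prop} {B : Finset (List α)}
    (h : IsHalfDecomposition R B) {b : List α} (hb : b ∈ B) : ∃ x y, [x, y] <+ b := by
  obtain ⟨x, hx⟩ := List.exists_mem_of_length_pos
    (l := b) (by rw [(h.isBlock b hb).2]; norm_num)
  obtain ⟨y, hy | hy⟩ := exists_mem_pair (h.isBlock b hb).2 hx
  exacts [⟨x, y, hy⟩, ⟨y, x, hy⟩]

theorem Swappable.map (f : α → β) {b c : List α} (h : Swappable b c) :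
    Swappable (b.map f) (c.map f) := by
  obtain ⟨x, y, hb, hc⟩ := h
  exact ⟨f x, f y, hb.map f, hc.map f⟩

theorem map_map_eq_self {f : α → β} {g : β → α} {b : List α} (h : ∀ x ∈ b, g (f x) = x) :
    (b.map f).map g = b := by
  rw [List.map_map]
  exact (List.map_congr_left (g := id) h).trans (List.map_id _)

/-- Decompositions can be transported along a map which is injective on the points in use. -/
theorem HalfDecomposable.transport {R : α → α → Prop} (h : HalfDecomposable R)
    (f : α → β) (g : β → α) {s : Set α} (hs : ∀ x y, R x y → x ∈ s ∧ y ∈ s)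
    (hgf : ∀ x ∈ s, g (f x) = x) {R' : β → β → Prop}
    (hR' : ∀ p q, R' p q ↔ ∃ x y, R x y ∧ f x = p ∧ f y = q) : HalfDecomposable R' := by
  obtain ⟨B, hB⟩ := h
  have hmem : ∀ b ∈ B, ∀ x ∈ b, x ∈ s := by
    intro b hb x hx
    obtain ⟨y, h | h⟩ := hB.mem_left_or_right hb hx
    exacts [(hs x y h).1, (hs y x h).2]
  have hinv : ∀ b ∈ B, (b.map f).map g = b := fun b hb =>
    map_map_eq_self fun x hx => hgf x (hmem b hb x hx)
  have hinj : Set.InjOn (List.map f) (B : Set (List α)) := by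
    intro b hb c hc hbc
    rw [← hinv b hb, ← hinv c hc, hbc]
  have hback : ∀ b ∈ B, ∀ p q, [p, q] <+ b.map f → [g p, g q] <+ b := by
    intro b hb p q hpq
    have := hpq.map g
    rwa [hinv b hb] at this
  refine ⟨B.image (List.map f), ?_, ?_, ?_, ?_, ?_, ?_⟩
  · simp only [Finset.mem_image, forall_exists_index, and_imp, forall_apply_eq_imp_iff₂]
    intro b hb
    refine ⟨?_, by rw [List.length_map, (hB.isBlock b hb).2]⟩
    refine List.Nodup.of_map g ?_
    rw [hinv b hb]
    exact (hB.isBlock b hb).1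
  · simp only [Finset.mem_image, forall_exists_index, and_imp, forall_apply_eq_imp_iff₂]
    intro b hb p q hpq
    obtain ⟨x, y, hxy, rfl, rfl⟩ := pair_sublist_map hpq
    exact (hR' _ _).2 ⟨x, y, hB.rel b hb x y hxy, rfl, rfl⟩
  · intro p q hpq
    obtain ⟨x, y, hxy, rfl, rfl⟩ := (hR' p q).1 hpq
    obtain ⟨b, hb, hxyb⟩ := hB.exists_mem x y hxy
    exact ⟨b.map f, Finset.mem_image_of_mem _ hb, hxyb.map f⟩
  · simp only [Finset.mem_image, forall_exists_index, and_imp, forall_apply_eq_imp_iff₂]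
    intro b hb c hc p q hbpq hcpq
    rw [hB.unique b hb c hc _ _ (hback b hb p q hbpq) (hback c hc p q hcpq)]
  · simp only [Finset.mem_image, forall_exists_index, and_imp, forall_apply_eq_imp_iff₂]
    intro b hb c hc hbc
    refine le_trans ?_ (hB.superSimple b hb c hc fun h => hbc (by rw [h]))
    refine le_trans (Finset.card_le_card ?_) (Finset.card_image_le (f := f))
    intro p hp
    simp only [Finset.mem_inter, List.mem_toFinset, List.mem_map, Finset.mem_image] at hp ⊢
    obtain ⟨⟨x, hx, rfl⟩, y, hy, hyx⟩ := hp
    have : y = x := by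
      rw [← hgf x (hmem b hb x hx), ← hgf y (hmem c hc y hy), hyx]
    exact ⟨x, ⟨hx, this ▸ hy⟩, rfl⟩
  · intro S hS hmeets
    rw [Finset.card_image_of_injOn hinj]
    have hcard : (B.filter fun b => b.map f ∈ S).card ≤ S.card :=
      Finset.card_le_card_of_injOn (List.map f) (fun b hb => (Finset.mem_filter.1 hb).2)
        (hinj.mono fun b hb => (Finset.mem_filter.1 hb).1)
    refine le_trans (hB.half _ (Finset.filter_subset _ _) ?_) (Nat.mul_le_mul_left 2 hcard)
    intro b hb c hc hbc
    have := hmeets _ (Finset.mem_image_of_mem _ hb) _ (Finset.mem_image_of_mem _ hc)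
      (hbc.map f)
    simpa only [Finset.mem_filter, hb, hc, true_and] using this

/-- Edge-disjoint decompositions can be put together. -/
theorem HalfDecomposable.iUnion [Fintype ι] {R : α → α → Prop} {Q : ι → α → α → Prop}
    (hQ : ∀ i, HalfDecomposable (Q i)) (hR : ∀ x y, R x y ↔ ∃ i, Q i x y)
    (hsymm : ∀ i x y, Q i x y → Q i y x)
    (hdisj : ∀ i j x y, Q i x y → Q j x y → i = j) : HalfDecomposable R := by
  choose B hB using hQ
  have hpair : ∀ i j, ∀ b ∈ B i, ∀ c ∈ B j, ∀ x y, [x, y] <+ b → [x, y] <+ c → i = j :=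
    fun i j b hb c hc x y hbxy hcxy =>
      hdisj i j x y ((hB i).rel b hb x y hbxy) ((hB j).rel c hc x y hcxy)
  have hdisjoint : ∀ i j, i ≠ j → Disjoint (B i) (B j) := by
    intro i j hij
    rw [Finset.disjoint_left]
    intro b hbi hbj
    obtain ⟨x, y, hxy⟩ := (hB i).exists_rel hbi
    exact hij (hpair i j b hbi b hbj x y hxy hxy)
  have hmem : ∀ b, b ∈ Finset.univ.biUnion B ↔ ∃ i, b ∈ B i := by simp
  refine ⟨Finset.univ.biUnion B, ?_, ?_, ?_, ?_, ?_, ?_⟩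
  · intro b hb
    obtain ⟨i, hi⟩ := (hmem b).1 hb
    exact (hB i).isBlock b hi
  · intro b hb x y hxy
    obtain ⟨i, hi⟩ := (hmem b).1 hb
    exact (hR x y).2 ⟨i, (hB i).rel b hi x y hxy⟩
  · intro x y hxy
    obtain ⟨i, hi⟩ := (hR x y).1 hxy
    obtain ⟨b, hb, hbxy⟩ := (hB i).exists_mem x y hi
    exact ⟨b, (hmem b).2 ⟨i, hb⟩, hbxy⟩
  · intro b hb c hc x y hbxy hcxy
    obtain ⟨i, hi⟩ := (hmem b).1 hb
    obtain ⟨j, hj⟩ := (hmem c).1 hc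
    obtain rfl := hpair i j b hi c hj x y hbxy hcxy
    exact (hB i).unique b hi c hj x y hbxy hcxy
  · intro b hb c hc hbc
    obtain ⟨i, hi⟩ := (hmem b).1 hb
    obtain ⟨j, hj⟩ := (hmem c).1 hc
    by_contra! h
    obtain ⟨x, hx, y, hy, hxy⟩ := Finset.one_lt_card.1 (lt_trans (by norm_num) h)
    simp only [Finset.mem_inter, List.mem_toFinset] at hx hy
    have hrel : ∀ k, ∀ d ∈ B k, x ∈ d → y ∈ d → Q k x y := by
      intro k d hd hxd hyd
      rcases exists_pair_sublist ((hB k).isBlock d hd).1 hxd hyd hxy with h | h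
      · exact (hB k).rel d hd x y h
      · exact hsymm k y x ((hB k).rel d hd y x h)
    obtain rfl := hdisj i j x y (hrel i b hi hx.1 hy.1) (hrel j c hj hx.2 hy.2)
    exact absurd ((hB i).superSimple b hi c hj hbc) (not_le.2 h)
  · intro S hS hmeets
    have hSeq : S = Finset.univ.biUnion fun i => S ∩ B i := by
      ext b
      simp only [Finset.mem_biUnion, Finset.mem_univ, true_and, Finset.mem_inter]
      constructor
      · intro hb
        obtain ⟨i, hi⟩ := (hmem b).1 (hS hb)
        exact ⟨i, hb, hi⟩
      · rintro ⟨i, hb, -⟩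
        exact hb
    have hScard : S.card = ∑ i, (S ∩ B i).card := by
      conv_lhs => rw [hSeq]
      exact Finset.card_biUnion fun i _ j _ hij =>
        (hdisjoint i j hij).mono Finset.inter_subset_right Finset.inter_subset_right
    rw [Finset.card_biUnion fun i _ j _ hij => hdisjoint i j hij, hScard, Finset.mul_sum]
    refine Finset.sum_le_sum fun i _ => (hB i).half _ Finset.inter_subset_right ?_
    intro b hb c hc hbc
    have := hmeets b ((hmem b).2 ⟨i, hb⟩) c ((hmem c).2 ⟨i, hc⟩) hbc
    simpa only [Finset.mem_inter, hb, hc, and_true] using this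

end Decompositions

section Translates

variable {G : Type*} [AddCommGroup G]

/-- The translate of a block. -/
def shiftBlock (h : G) (b : List G) : List G :=
  b.map (h + ·)

theorem shiftBlock_shiftBlock (h k : G) (b : List G) :
    shiftBlock h (shiftBlock k b) = shiftBlock (h + k) b := by
  rw [shiftBlock, shiftBlock, shiftBlock, List.map_map]
  exact List.map_congr_left fun x _ => (add_assoc h k x).symm

theorem shiftBlock_neg_shiftBlock (h : G) (b : List G) : shiftBlock (-h) (shiftBlock h b) = b := by
  rw [shiftBlock_shiftBlock, neg_add_cancel, shiftBlock]
  simp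

theorem mem_shiftBlock {h x : G} {b : List G} : x ∈ shiftBlock h b ↔ -h + x ∈ b := by
  simp only [shiftBlock, List.mem_map]
  constructor
  · rintro ⟨y, hy, rfl⟩
    rwa [neg_add_cancel_left]
  · exact fun hx => ⟨_, hx, add_neg_cancel_left h x⟩

theorem pair_sublist_shiftBlock {h x y : G} {b : List G} :
    [x, y] <+ shiftBlock h b ↔ [-h + x, -h + y] <+ b := by
  constructor
  · intro hxy
    have := hxy.map (-h + ·)
    change _ <+ shiftBlock (-h) (shiftBlock h b) at this
    rwa [shiftBlock_neg_shiftBlock] at this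
  · intro hxy
    have := hxy.map (h + ·)
    simpa only [shiftBlock, List.map_cons, List.map_nil, add_neg_cancel_left] using this

variable {R : G → G → Prop} {H : AddSubgroup G} {L : List (G × List (List G))}

theorem card_mul_length_le [Fintype H] {S : Finset (List G)} {r : G} (hr : r ∈ H) {b : List G}
    {l : List (List G)}
    (hS : ∀ c ∈ b :: l, ∀ d ∈ b :: l, ∀ h ∈ H, ∀ k ∈ H,
      Swappable (shiftBlock h c) (shiftBlock k d) → shiftBlock h c ∈ S ∨ shiftBlock k d ∈ S)
    (hchain : List.IsChain Swappable (b :: (l ++ [shiftBlock r b]))) :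
    Fintype.card H * (b :: l).length ≤
      2 * ∑ h : H, (b :: l).countP fun c => shiftBlock h.1 c ∈ S := by
  have hle : ∀ h : H, (b :: l).length ≤ (b :: l).countP (fun c => shiftBlock h.1 c ∈ S) +
      (l.countP (fun c => shiftBlock h.1 c ∈ S) +
        if shiftBlock (h.1 + r) b ∈ S then 1 else 0) := by
    intro h
    have := length_le_countP_chain (fun c => shiftBlock h.1 c ∈ S)
      (r := fun c d => shiftBlock h.1 c ∈ S ∨ shiftBlock h.1 d ∈ S) (fun _ _ h => h) b
      (l ++ [shiftBlock r b]) ?_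
    · rw [← List.cons_append, List.dropLast_concat, List.countP_append, List.countP_singleton,
        shiftBlock_shiftBlock] at this
      simpa using this
    · refine List.IsChain.imp_of_mem_imp ?_ hchain
      intro c d hc hd hcd
      have hmem : ∀ c ∈ b :: (l ++ [shiftBlock r b]), ∃ e ∈ b :: l, ∃ k ∈ H,
          shiftBlock h.1 c = shiftBlock k e := by
        intro c hc
        rw [← List.cons_append, List.mem_append, List.mem_singleton] at hc
        rcases hc with hc | rfl
        · exact ⟨c, hc, h.1, h.2, rfl⟩
        · exact ⟨b, List.mem_cons_self, h.1 + r, H.add_mem h.2 hr, shiftBlock_shiftBlock _ _ _⟩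
      obtain ⟨c', hc', k, hk, hkc⟩ := hmem c hc
      obtain ⟨d', hd', j, hj, hjd⟩ := hmem d hd
      have := hS c' hc' d' hd' k hk j hj
      rw [← hkc, ← hjd] at this
      exact this (hcd.map _)
  have hshift : ∑ h : H, (if shiftBlock (h.1 + r) b ∈ S then 1 else 0) =
      ∑ h : H, if shiftBlock h.1 b ∈ S then 1 else 0 :=
    Equiv.sum_comp (Equiv.addRight (⟨r, hr⟩ : H))
      fun h : H => if shiftBlock h.1 b ∈ S then 1 else 0
  calc Fintype.card H * (b :: l).length = ∑ h : H, (b :: l).length := by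
        rw [Finset.sum_const, smul_eq_mul, Finset.card_univ]
    _ ≤ _ := Finset.sum_le_sum fun h _ => hle h
    _ = _ := by
        rw [Finset.sum_add_distrib, Finset.sum_add_distrib, hshift, ← Finset.sum_add_distrib,
          two_mul]
        congr 1
        exact Finset.sum_congr rfl fun h _ => by simp [List.countP_cons]

/-- The translates by a subgroup `H` of cells of blocks, where consecutive blocks of a cell are
swappable, and the last one and a translate of the first one are swappable. -/
theorem halfDecomposable_of_cells [Finite G]
    (hR : ∀ h ∈ H, ∀ x y, R x y → R (h + x) (h + y))
    (hlength : ∀ b ∈ L.flatMap Prod.snd, b.length = 4)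
    (hne : ∀ x y, R x y → x ≠ y)
    (hrel : ∀ b ∈ L.flatMap Prod.snd, ∀ x y, [x, y] <+ b → R x y)
    (hexists : ∀ x y, R x y → ∃ b ∈ L.flatMap Prod.snd, ∃ h ∈ H, [-h + x, -h + y] <+ b)
    (hnodup : (L.flatMap Prod.snd).Nodup)
    (hunique : ∀ b ∈ L.flatMap Prod.snd, ∀ c ∈ L.flatMap Prod.snd, ∀ h ∈ H, ∀ x y,
      [x, y] <+ b → [h + x, h + y] <+ c → b = c ∧ h = 0)
    (htriple : ∀ b ∈ L.flatMap Prod.snd, ∀ c ∈ L.flatMap Prod.snd, ∀ h ∈ H, ∀ x y z,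
      x ≠ y → x ≠ z → y ≠ z → x ∈ b → y ∈ b → z ∈ b → h + x ∈ c → h + y ∈ c → h + z ∈ c →
        b = c ∧ h = 0)
    (hcell : ∀ p ∈ L, p.1 ∈ H ∧ ∀ b l, p.2 = b :: l →
      List.IsChain Swappable (b :: (l ++ [shiftBlock p.1 b]))) : HalfDecomposable R := by
  have := Fintype.ofFinite H
  set M := L.flatMap Prod.snd with hM
  set B : Finset (List G) :=
    (Finset.univ.sigma fun _ : H => M.toFinset).image fun p => shiftBlock p.1.1 p.2 with hB
  have hmem : ∀ b, b ∈ B ↔ ∃ h ∈ H, ∃ c ∈ M, shiftBlock h c = b := by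
    intro b
    simp [hB]
  have huniq : ∀ b ∈ M, ∀ c ∈ M, ∀ h ∈ H, ∀ k ∈ H, ∀ x y,
      [x, y] <+ shiftBlock h b → [x, y] <+ shiftBlock k c → b = c ∧ h = k := by
    intro b hb c hc h hh k hk x y hbxy hcxy
    rw [pair_sublist_shiftBlock] at hbxy hcxy
    have := hunique b hb c hc (-k + h) (H.add_mem (H.neg_mem hk) hh) (-h + x) (-h + y) hbxy
      (by simpa only [add_assoc, add_neg_cancel_left] using hcxy)
    exact ⟨this.1, (neg_add_eq_zero.1 this.2).symm⟩
  have hinj : Set.InjOn (fun p : (_ : H) × List G => shiftBlock p.1.1 p.2)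
      (Finset.univ.sigma fun _ : H => M.toFinset : Finset ((_ : H) × List G)) := by
    rintro ⟨h, b⟩ hb ⟨k, c⟩ hc hbc
    simp only [Finset.coe_sigma, Set.mem_sigma_iff, Finset.mem_coe, List.mem_toFinset] at hb hc hbc
    obtain ⟨x, hx⟩ := List.exists_mem_of_length_pos (l := b) (by rw [hlength b hb.2]; norm_num)
    obtain ⟨x, y, hxy⟩ : ∃ x y, [x, y] <+ b := by
      obtain ⟨y, hy | hy⟩ := exists_mem_pair (hlength b hb.2) hx
      exacts [⟨x, y, hy⟩, ⟨y, x, hy⟩]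
    have hxy' : [h.1 + x, h.1 + y] <+ shiftBlock h.1 b := hxy.map _
    obtain ⟨rfl, hhk⟩ := huniq b hb.2 c hc.2 h h.2 k k.2 _ _ hxy' (hbc ▸ hxy')
    obtain rfl := Subtype.ext hhk
    rfl
  have hblock : ∀ b ∈ M, b.Nodup := fun b hb =>
    nodup_of_forall_ne fun x y hxy => hne x y (hrel b hb x y hxy)
  have hblock' : ∀ h, ∀ b ∈ M, (shiftBlock h b).Nodup := fun h b hb =>
    (hblock b hb).map (add_right_injective h)
  refine ⟨B, ?_, ?_, ?_, ?_, ?_, ?_⟩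
  · intro b hb
    obtain ⟨h, -, b, hbM, rfl⟩ := (hmem b).1 hb
    exact ⟨hblock' h b hbM, by rw [shiftBlock, List.length_map, hlength b hbM]⟩
  · intro b hb x y hxy
    obtain ⟨h, hh, b, hbM, rfl⟩ := (hmem b).1 hb
    have := hR h hh _ _ (hrel b hbM _ _ (pair_sublist_shiftBlock.1 hxy))
    rwa [add_neg_cancel_left, add_neg_cancel_left] at this
  · intro x y hxy
    obtain ⟨b, hb, h, hh, hbxy⟩ := hexists x y hxy
    exact ⟨shiftBlock h b, (hmem _).2 ⟨h, hh, b, hb, rfl⟩, pair_sublist_shiftBlock.2 hbxy⟩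
  · intro b hb c hc x y hbxy hcxy
    obtain ⟨h, hh, b, hbM, rfl⟩ := (hmem b).1 hb
    obtain ⟨k, hk, c, hcM, rfl⟩ := (hmem c).1 hc
    obtain ⟨rfl, rfl⟩ := huniq b hbM c hcM h hh k hk x y hbxy hcxy
    rfl
  · intro b hb c hc hbc
    obtain ⟨h, hh, b, hbM, rfl⟩ := (hmem b).1 hb
    obtain ⟨k, hk, c, hcM, rfl⟩ := (hmem c).1 hc
    by_contra! hcard
    obtain ⟨x, y, z, hx, hy, hz, hxy, hxz, hyz⟩ := Finset.two_lt_card_iff.1 hcard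
    simp only [Finset.mem_inter, List.mem_toFinset, mem_shiftBlock] at hx hy hz
    have hk' : ∀ x, -k + h + (-h + x) = -k + x := fun x => by abel
    obtain ⟨rfl, hhk⟩ := htriple b hbM c hcM (-k + h) (H.add_mem (H.neg_mem hk) hh) (-h + x)
      (-h + y) (-h + z) (by simpa using hxy) (by simpa using hxz) (by simpa using hyz)
      hx.1 hy.1 hz.1 (by rw [hk']; exact hx.2) (by rw [hk']; exact hy.2)
      (by rw [hk']; exact hz.2)
    exact hbc (by rw [neg_add_eq_zero.1 hhk])
  · intro S hS hmeets
    have hcard : ∑ h : H, M.countP (fun c => shiftBlock h.1 c ∈ S) ≤ S.card := by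
      have : ∀ h : H, M.countP (fun c => shiftBlock h.1 c ∈ S) =
          (M.toFinset.filter fun c => shiftBlock h.1 c ∈ S).card := by
        intro h
        rw [List.countP_eq_length_filter, ← List.toFinset_card_of_nodup (hnodup.filter _)]
        congr 1
        ext c
        simp
      rw [Finset.sum_congr rfl fun h _ => this h, ← Finset.card_sigma]
      refine Finset.card_le_card_of_injOn (fun p => shiftBlock p.1.1 p.2) ?_ (hinj.mono ?_)
      · intro p hp
        exact (Finset.mem_filter.1 (Finset.mem_sigma.1 hp).2).2
      · intro p hp
        have := Finset.mem_sigma.1 hp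
        exact Finset.mem_sigma.2 ⟨this.1, (Finset.mem_filter.1 this.2).1⟩
    have hhalf : Fintype.card H * M.length ≤
        2 * ∑ h : H, M.countP fun c => shiftBlock h.1 c ∈ S := by
      have hsub : ∀ p ∈ L, ∀ b ∈ p.2, b ∈ M := fun p hp b hb =>
        List.mem_flatMap.2 ⟨p, hp, hb⟩
      clear_value M
      subst hM
      have key : ∀ p ∈ L, Fintype.card H * p.2.length ≤
          2 * ∑ h : H, p.2.countP fun c => shiftBlock h.1 c ∈ S := by
        rintro ⟨r, C⟩ hp
        obtain ⟨hr, hchain⟩ := hcell _ hp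
        cases C with
        | nil => simp
        | cons b l =>
          refine card_mul_length_le hr ?_ (hchain b l rfl)
          intro c hc d hd h hh k hk
          exact hmeets _ ((hmem _).2 ⟨h, hh, c, hsub _ hp c hc, rfl⟩) _
            ((hmem _).2 ⟨k, hk, d, hsub _ hp d hd, rfl⟩)
      clear * - key
      induction L with
      | nil => simp
      | cons p L ih =>
        simp only [List.flatMap_cons, List.length_append, List.countP_append,
          Finset.sum_add_distrib, mul_add]
        exact add_le_add (key p List.mem_cons_self)
          (ih fun q hq => key q (List.mem_cons_of_mem _ hq))
    rw [hB, Finset.card_image_of_injOn hinj, Finset.card_sigma, Finset.sum_const,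
      Finset.card_univ, smul_eq_mul, List.toFinset_card_of_nodup hnodup]
    exact hhalf.trans (Nat.mul_le_mul_left 2 hcard)

end Translates

section Certificates

/-- The bit mask obtained by switching on the bits in the list, or `none` if some bit is already
on. -/
def switchOn : List ℕ → ℕ → Option ℕ
  | [], m => some m
  | c :: l, m => match m.testBit c with
    | true => none
    | false => switchOn l (m ||| 1 <<< c)

/-- Boolean version of `Swappable`. -/
def swappableTest (b c : List ℕ) : Bool :=
  (consecutivePairs b).any fun p =>
    (consecutivePairs c).any fun q => p.1.beq q.2 && p.2.beq q.1

/-- Consecutive entries of the list are swappable. -/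
def chainTest : List ℕ → List (List ℕ) → Bool
  | _, [] => true
  | b, c :: l => swappableTest b c && chainTest c l

/-- The ordered triples of distinct entries of a list. -/
def arrangements (b : List ℕ) : List (ℕ × ℕ × ℕ) :=
  b.flatMap fun x => b.flatMap fun y =>
    (b.filter fun z => !x.beq y && !x.beq z && !y.beq z).map fun z => (x, y, z)

/-- A code for the orbit of a pair modulo `N` under translations by multiples of `m`. -/
def pairCode (N m x y : ℕ) : ℕ :=
  x % m * N + (y + (N - x)) % N

/-- A code for the orbit of a triple modulo `N` under translations by multiples of `m`. -/
def tripleCode (N m x y z : ℕ) : ℕ :=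
  pairCode N m x y * N + (z + (N - x)) % N

/-- Test for the blocks of a decomposition modulo `N`, with translations by multiples of `m`, of
the complete multipartite graph whose parts are the residue classes modulo `k`. -/
def blocksTest (N m k : ℕ) (M : List (List ℕ)) : Bool :=
  M.all (fun b => b.length.beq 4 && b.all (fun x => Nat.blt x N) &&
    (orderedPairs b).all fun p => !(p.1 % k).beq (p.2 % k)) &&
  (match switchOn (M.flatMap fun b => (orderedPairs b).map fun p => pairCode N m p.1 p.2) 0 with
    | none => false
    | some s => (List.range (m * N)).all fun c => (c % N % k).beq 0 || s.testBit c) &&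
  (switchOn (M.flatMap fun b => (arrangements b).map fun p => tripleCode N m p.1 p.2.1 p.2.2)
    0).isSome

/-- Cyclically consecutive blocks of the cell are swappable, where the last block is followed by
the translate of the first one by `r * m`. -/
def cellTest (N m r : ℕ) : List (List ℕ) → Bool
  | [] => true
  | b :: l => chainTest b (l ++ [b.map fun a => (m * r + a) % N])

theorem testBit_or_shiftLeft (m c d : ℕ) :
    (m ||| 1 <<< c).testBit d = true ↔ m.testBit d = true ∨ d = c := by
  rw [Nat.testBit_or, Nat.one_shiftLeft, Nat.testBit_two_pow, Bool.or_eq_true, decide_eq_true_eq,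
    eq_comm (a := c)]

theorem switchOn_eq_some {l : List ℕ} {m m' : ℕ} (h : switchOn l m = some m') :
    l.Nodup ∧ (∀ c ∈ l, ¬ m.testBit c = true) ∧
      ∀ d, m'.testBit d = true → m.testBit d = true ∨ d ∈ l := by
  induction l generalizing m with
  | nil =>
    simp only [switchOn, Option.some.injEq] at h
    subst h
    simp
  | cons c l ih =>
    simp only [switchOn] at h
    split at h
    · simp at h
    · rename_i hc
      obtain ⟨h1, h2, h3⟩ := ih h
      simp only [testBit_or_shiftLeft, not_or] at h2 h3
      refine ⟨List.nodup_cons.2 ⟨fun hcl => (h2 c hcl).2 rfl, h1⟩, ?_, ?_⟩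
      · intro d hd
        rcases List.mem_cons.1 hd with rfl | hd
        · simp [hc]
        · exact (h2 d hd).1
      · intro d hd
        rcases h3 d hd with (h | rfl) | h
        · exact Or.inl h
        · exact Or.inr List.mem_cons_self
        · exact Or.inr (List.mem_cons_of_mem _ h)

theorem swappable_of_test {b c : List ℕ} (h : swappableTest b c = true) : Swappable b c := by
  simp only [swappableTest, List.any_eq_true, Bool.and_eq_true, Nat.beq_eq] at h
  obtain ⟨⟨x, y⟩, hp, ⟨z, w⟩, hq, h1, h2⟩ := h
  dsimp only at h1 h2
  subst h1 h2
  exact ⟨x, y, isInfix_of_mem_consecutivePairs hp, isInfix_of_mem_consecutivePairs hq⟩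

theorem isChain_of_test {b : List ℕ} {l : List (List ℕ)} (h : chainTest b l = true) :
    List.IsChain Swappable (b :: l) := by
  induction l generalizing b with
  | nil => exact List.isChain_singleton b
  | cons c l ih =>
    simp only [chainTest, Bool.and_eq_true] at h
    exact List.isChain_cons_cons.2 ⟨swappable_of_test h.1, ih h.2⟩

theorem eq_of_nodup_flatMap {α β γ : Type*} {l : List α} {f : α → List β} {g : β → γ}
    (h : (l.flatMap fun a => (f a).map g).Nodup) {a b : α} (ha : a ∈ l) (hb : b ∈ l) {x y : β}
    (hx : x ∈ f a) (hy : y ∈ f b) (hxy : g x = g y) : a = b ∧ x = y := by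
  induction l with
  | nil => simp at ha
  | cons c l ih =>
    rw [List.flatMap_cons, List.nodup_append'] at h
    obtain ⟨h1, h2, h3⟩ := h
    rcases List.mem_cons.1 ha with rfl | ha' <;> rcases List.mem_cons.1 hb with rfl | hb'
    · exact ⟨rfl, List.inj_on_of_nodup_map h1 hx hy hxy⟩
    · exact absurd (List.mem_flatMap.2 ⟨b, hb', List.mem_map.2 ⟨y, hy, hxy.symm⟩⟩)
        (h3 (List.mem_map_of_mem hx))
    · exact absurd (List.mem_flatMap.2 ⟨a, ha', List.mem_map.2 ⟨x, hx, hxy⟩⟩)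
        (h3 (List.mem_map_of_mem hy))
    · exact ih h2 ha' hb'

theorem nodup_of_nodup_flatMap {α β : Type*} {l : List α} {f : α → List β}
    (h : (l.flatMap f).Nodup) (hne : ∀ a ∈ l, f a ≠ []) : l.Nodup := by
  induction l with
  | nil => exact List.nodup_nil
  | cons c l ih =>
    rw [List.flatMap_cons, List.nodup_append'] at h
    refine List.nodup_cons.2 ⟨fun hc => ?_, ih h.2.1 fun a ha => hne a (List.mem_cons_of_mem _ ha)⟩
    obtain ⟨x, hx⟩ := List.exists_mem_of_ne_nil _ (hne c List.mem_cons_self)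
    exact h.2.2 hx (List.mem_flatMap.2 ⟨c, hc, hx⟩)

theorem mem_arrangements {b : List ℕ} {x y z : ℕ} (hx : x ∈ b) (hy : y ∈ b) (hz : z ∈ b)
    (hxy : x ≠ y) (hxz : x ≠ z) (hyz : y ≠ z) : (x, y, z) ∈ arrangements b := by
  simp only [arrangements, List.mem_flatMap, List.mem_map, List.mem_filter]
  refine ⟨x, hx, y, hy, z, ⟨hz, ?_⟩, rfl⟩
  simp only [Bool.and_eq_true, Bool.not_eq_true', ← Bool.not_eq_true, Nat.beq_eq]
  exact ⟨⟨hxy, hxz⟩, hyz⟩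

variable {N m k : ℕ}

theorem natCast_sub_mod {x : ℕ} (hx : x < N) (y : ℕ) :
    (((y + (N - x)) % N : ℕ) : ZMod N) = y - x := by
  rw [ZMod.natCast_mod, Nat.cast_add, Nat.cast_sub hx.le, ZMod.natCast_self]
  ring

theorem sub_mod_eq {h : ZMod N} {x y x' y' : ℕ} (hx : x < N) (hx' : x' < N)
    (hxx : h + x = x') (hyy : h + y = y') : (y + (N - x)) % N = (y' + (N - x')) % N := by
  have : (((y + (N - x)) % N : ℕ) : ZMod N) = ((y' + (N - x')) % N : ℕ) := by
    rw [natCast_sub_mod hx, natCast_sub_mod hx', ← hxx, ← hyy]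
    ring
  rw [ZMod.natCast_eq_natCast_iff'] at this
  simpa only [Nat.mod_mod] using this

theorem pairCode_eq (hm : m ∣ N) {h : ZMod N} (hh : ZMod.castHom hm (ZMod m) h = 0)
    {x y x' y' : ℕ} (hx : x < N) (hx' : x' < N) (hxx : h + x = x') (hyy : h + y = y') :
    pairCode N m x y = pairCode N m x' y' := by
  have : (x : ZMod m) = x' := by
    rw [← map_natCast (ZMod.castHom hm (ZMod m)) x', ← hxx, map_add, hh, zero_add, map_natCast]
  rw [pairCode, pairCode, (ZMod.natCast_eq_natCast_iff' _ _ _).1 this, sub_mod_eq hx hx' hxx hyy]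

theorem halfDecomposable_of_test {L : List (ℕ × List (List ℕ))} (hN : 0 < N) (hm : m ∣ N)
    (hk : k ∣ N) (hblocks : blocksTest N m k (L.flatMap Prod.snd) = true)
    (hcells : L.all (fun p => cellTest N m p.1 p.2) = true) :
    HalfDecomposable fun x y => x < N ∧ y < N ∧ x % k ≠ y % k := by
  have : NeZero N := ⟨hN.ne'⟩
  simp only [blocksTest, Bool.and_eq_true] at hblocks
  obtain ⟨⟨hblock, hpairs⟩, htriples⟩ := hblocks
  rw [List.all_eq_true] at hblock hcells
  simp only [Bool.and_eq_true, Nat.beq_eq, List.all_eq_true, Bool.not_eq_true',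
    Nat.blt_eq, Prod.forall, mem_orderedPairs] at hblock
  split at hpairs
  · simp at hpairs
  rename_i s hs
  obtain ⟨hnodup, -, hmask⟩ := switchOn_eq_some hs
  obtain ⟨s', hs'⟩ := Option.isSome_iff_exists.1 htriples
  obtain ⟨hnodup', -, -⟩ := switchOn_eq_some hs'
  simp only [Nat.zero_testBit, Bool.false_eq_true, false_or] at hmask
  set M := L.flatMap Prod.snd with hM
  set toZMod : List ℕ → List (ZMod N) := List.map Nat.cast with htoZMod
  have hval : ∀ b ∈ M, (toZMod b).map ZMod.val = b := fun b hb =>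
    map_map_eq_self fun x hx => ZMod.val_cast_of_lt ((hblock b hb).1.2 x hx)
  have hinj : ∀ b ∈ M, ∀ c ∈ M, toZMod b = toZMod c → b = c := fun b hb c hc h => by
    rw [← hval b hb, h, hval c hc]
  have hflat : M.Nodup := by
    refine nodup_of_nodup_flatMap hnodup fun b hb hnil => ?_
    match b, (hblock b hb).1.1, hnil with
    | [x, y, z, w], _, hnil => simp [orderedPairs] at hnil
  have hcast : ∀ x : ZMod N, ((x.val : ℕ) : ZMod N) = x := ZMod.natCast_zmod_val
  have hkcast : ∀ x : ℕ, ZMod.castHom hk (ZMod k) x = (x : ZMod k) := map_natCast _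
  have hmcast : ∀ x : ℕ, ZMod.castHom hm (ZMod m) x = (x : ZMod m) := map_natCast _
  have hzmod : HalfDecomposable fun x y : ZMod N =>
      ZMod.castHom hk (ZMod k) x ≠ ZMod.castHom hk (ZMod k) y := by
    have hflatMap : (L.map fun p => (((m * p.1 : ℕ) : ZMod N), p.2.map toZMod)).flatMap Prod.snd =
        M.map toZMod := by
      rw [List.flatMap_map, hM, List.map_flatMap]
    refine halfDecomposable_of_cells (H := (ZMod.castHom hm (ZMod m)).toAddMonoidHom.ker)
      (L := L.map fun p => (((m * p.1 : ℕ) : ZMod N), p.2.map toZMod))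
      ?_ ?_ ?_ ?_ ?_ ?_ ?_ ?_ ?_
    · intro h _ x y hxy heq
      rw [map_add, map_add] at heq
      exact hxy (add_left_cancel heq)
    · rw [hflatMap]
      simp only [List.mem_map, forall_exists_index, and_imp, forall_apply_eq_imp_iff₂]
      intro b hb
      rw [htoZMod, List.length_map, (hblock b hb).1.1]
    · rintro x y hxy rfl
      exact hxy rfl
    · rw [hflatMap]
      simp only [List.mem_map, forall_exists_index, and_imp, forall_apply_eq_imp_iff₂]
      intro b hb p q hpq
      obtain ⟨x, y, hxy, rfl, rfl⟩ := pair_sublist_map hpq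
      have := (hblock b hb).2 x y hxy
      rw [hkcast, hkcast, Ne, ZMod.natCast_eq_natCast_iff']
      intro h
      simp [h] at this
    · rw [hflatMap]
      intro x y hxy
      have hd : ¬ (y - x).val % k = 0 := by
        rw [← Nat.zero_mod k, ← ZMod.natCast_eq_natCast_iff', ← hkcast, hcast, map_sub,
          Nat.cast_zero, sub_eq_zero]
        exact fun h => hxy h.symm
      have hm0 : 0 < m := Nat.pos_of_dvd_of_pos hm hN
      have hdN := ZMod.val_lt (y - x)
      have hxm := Nat.mod_lt x.val hm0
      have hmem : x.val % m * N + (y - x).val ∈ List.range (m * N) := by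
        rw [List.mem_range]
        nlinarith
      have := List.all_eq_true.1 hpairs _ hmem
      rw [Nat.mul_add_mod_self_right, Nat.mod_eq_of_lt hdN, Bool.or_eq_true, Nat.beq_eq] at this
      obtain ⟨b, hb, hcode⟩ := List.mem_flatMap.1 (hmask _ (this.resolve_left hd))
      obtain ⟨⟨z, w⟩, hzw, hcode⟩ := List.mem_map.1 hcode
      rw [mem_orderedPairs] at hzw
      have hz : z < N := (hblock b hb).1.2 z (hzw.subset (by simp))
      dsimp only [pairCode] at hcode
      have hmod := congrArg (· % N) hcode
      simp only [Nat.mul_add_mod_self_right, Nat.mod_mod, Nat.mod_eq_of_lt hdN] at hmod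
      rw [hmod, add_left_inj, Nat.mul_left_inj hN.ne'] at hcode
      have hwz : (w : ZMod N) - z = y - x := by
        rw [← natCast_sub_mod hz, hmod, hcast]
      refine ⟨toZMod b, List.mem_map_of_mem hb, x - z, ?_, ?_⟩
      · rw [AddMonoidHom.mem_ker]
        change ZMod.castHom hm (ZMod m) (x - z) = 0
        rw [map_sub, sub_eq_zero, ← hcast x, hmcast, hmcast, ZMod.natCast_eq_natCast_iff', hcode]
      · have := hzw.map (Nat.cast : ℕ → ZMod N)
        have h1 : -(x - (z : ZMod N)) + x = z := by ring
        have h2 : -(x - (z : ZMod N)) + y = w := by linear_combination -hwz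
        rw [h1, h2]
        exact this
    · rw [hflatMap]
      exact hflat.map_on fun b hb c hc => hinj b hb c hc
    · rw [hflatMap]
      simp only [List.mem_map, forall_exists_index, and_imp, forall_apply_eq_imp_iff₂]
      intro b hb c hc h hh p q hbpq hcpq
      obtain ⟨x, y, hbxy, rfl, rfl⟩ := pair_sublist_map hbpq
      obtain ⟨x', y', hcxy, hx', hy'⟩ := pair_sublist_map hcpq
      have hx : x < N := (hblock b hb).1.2 x (hbxy.subset (by simp))
      have hxN' : x' < N := (hblock c hc).1.2 x' (hcxy.subset (by simp))
      obtain ⟨rfl, heq⟩ := eq_of_nodup_flatMap hnodup hb hc (mem_orderedPairs.2 hbxy)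
        (mem_orderedPairs.2 hcxy) (pairCode_eq hm hh hx hxN' hx'.symm hy'.symm)
      simp only [Prod.mk.injEq] at heq
      rw [heq.1] at hx'
      exact ⟨rfl, by simpa using hx'⟩
    · rw [hflatMap]
      simp only [List.mem_map, forall_exists_index, and_imp, forall_apply_eq_imp_iff₂]
      intro b hb c hc h hh x y z hxy hxz hyz hx hy hz hx' hy' hz'
      simp only [htoZMod, List.mem_map] at hx hy hz hx' hy' hz'
      obtain ⟨x, hx, rfl⟩ := hx
      obtain ⟨y, hy, rfl⟩ := hy
      obtain ⟨z, hz, rfl⟩ := hz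
      obtain ⟨x', hx', hxx⟩ := hx'
      obtain ⟨y', hy', hyy⟩ := hy'
      obtain ⟨z', hz', hzz⟩ := hz'
      have hne : ∀ {x y x' y' : ℕ}, (x : ZMod N) ≠ y → (x' : ZMod N) = h + x →
          (y' : ZMod N) = h + y → x ≠ y ∧ x' ≠ y' := by
        intro x y x' y' hxy hxx hyy
        refine ⟨fun h => hxy (by rw [h]), ?_⟩
        rintro rfl
        exact hxy (add_left_cancel (hxx.symm.trans hyy))
      have hxN := (hblock b hb).1.2 x hx
      have hxN' := (hblock c hc).1.2 x' hx'
      obtain ⟨rfl, heq⟩ := eq_of_nodup_flatMap hnodup' hb hc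
        (mem_arrangements hx hy hz (hne hxy hxx hyy).1 (hne hxz hxx hzz).1 (hne hyz hyy hzz).1)
        (mem_arrangements hx' hy' hz' (hne hxy hxx hyy).2 (hne hxz hxx hzz).2
          (hne hyz hyy hzz).2)
        (by
          dsimp only
          rw [tripleCode, tripleCode, pairCode_eq hm hh hxN hxN' hxx.symm hyy.symm,
            sub_mod_eq hxN hxN' hxx.symm hzz.symm])
      simp only [Prod.mk.injEq] at heq
      rw [heq.1] at hxx
      exact ⟨rfl, by simpa using hxx⟩
    · simp only [List.mem_map, forall_exists_index, and_imp, forall_apply_eq_imp_iff₂]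
      rintro ⟨r, C⟩ hC
      constructor
      · rw [AddMonoidHom.mem_ker]
        change ZMod.castHom hm (ZMod m) ((m * r : ℕ) : ZMod N) = 0
        rw [hmcast]
        simp
      · intro b l hbl
        have htest := hcells _ hC
        dsimp only at htest hbl
        match C, hbl, htest with
        | b' :: l', hbl, htest =>
          rw [List.map_cons, List.cons.injEq] at hbl
          obtain ⟨rfl, rfl⟩ := hbl
          have hchain := List.isChain_map_of_isChain toZMod
            (fun b c h => Swappable.map Nat.cast h) (isChain_of_test htest)
          simpa [htoZMod, shiftBlock, Function.comp_def] using hchain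
  refine hzmod.transport ZMod.val Nat.cast (s := Set.univ) (fun _ _ _ => ⟨trivial, trivial⟩)
    (fun x _ => hcast x) fun p q => ⟨?_, ?_⟩
  · rintro ⟨hp, hq, hpq⟩
    refine ⟨p, q, ?_, ZMod.val_cast_of_lt hp, ZMod.val_cast_of_lt hq⟩
    rwa [hkcast, hkcast, Ne, ZMod.natCast_eq_natCast_iff']
  · rintro ⟨x, y, hxy, rfl, rfl⟩
    refine ⟨ZMod.val_lt x, ZMod.val_lt y, ?_⟩
    rwa [← hcast x, ← hcast y, hkcast, hkcast, Ne, ZMod.natCast_eq_natCast_iff'] at hxy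

end Certificates

section BaseDesigns

theorem halfDecomposable_multipartite_four :
    HalfDecomposable fun x y => x < 12 ∧ y < 12 ∧ x % 4 ≠ y % 4 :=
  halfDecomposable_of_test (m := 4)
    (L := [(0, [[0, 9, 6, 3], [9, 0, 2, 7]]), (0, [[7, 2, 8, 1], [3, 6, 1, 8]]), (0, [[0, 11, 10,
    1], [9, 10, 11, 8]])])
    (by norm_num) (by norm_num) (by norm_num) (by decide +kernel) (by decide +kernel)

theorem halfDecomposable_multipartite_five :
    HalfDecomposable fun x y => x < 15 ∧ y < 15 ∧ x % 5 ≠ y % 5 :=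
  halfDecomposable_of_test (m := 1)
    (L := [(0, [[0, 1, 9, 13], [10, 9, 1, 12]])])
    (by norm_num) (by norm_num) (by norm_num) (by decide +kernel) (by decide +kernel)

theorem halfDecomposable_multipartite_six :
    HalfDecomposable fun x y => x < 18 ∧ y < 18 ∧ x % 6 ≠ y % 6 :=
  halfDecomposable_of_test (m := 2)
    (L := [(0, [[0, 1, 3, 17], [4, 1, 0, 8]]), (0, [[0, 5, 13, 10], [16, 5, 0, 9], [13, 5, 16,
    14]])])
    (by norm_num) (by norm_num) (by norm_num) (by decide +kernel) (by decide +kernel)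

theorem halfDecomposable_10 :
    HalfDecomposable fun x y => x < 10 ∧ y < 10 ∧ x % 10 ≠ y % 10 :=
  halfDecomposable_of_test (m := 2)
    (L := [(0, [[0, 2, 7, 6], [6, 7, 9, 5], [5, 9, 2, 0]])])
    (by norm_num) (by norm_num) (by norm_num) (by decide +kernel) (by decide +kernel)

theorem halfDecomposable_13 :
    HalfDecomposable fun x y => x < 13 ∧ y < 13 ∧ x % 13 ≠ y % 13 :=
  halfDecomposable_of_test (m := 1)
    (L := [(0, [[0, 1, 4, 6], [5, 4, 1, 12]])])
    (by norm_num) (by norm_num) (by norm_num) (by decide +kernel) (by decide +kernel)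

theorem halfDecomposable_16 :
    HalfDecomposable fun x y => x < 16 ∧ y < 16 ∧ x % 16 ≠ y % 16 :=
  halfDecomposable_of_test (m := 2)
    (L := [(0, [[0, 10, 2, 1], [14, 12, 1, 2]]), (2, [[0, 13, 9, 12]]), (0, [[1, 11, 8, 3], [13,
    11, 1, 6]])])
    (by norm_num) (by norm_num) (by norm_num) (by decide +kernel) (by decide +kernel)

theorem halfDecomposable_19 :
    HalfDecomposable fun x y => x < 19 ∧ y < 19 ∧ x % 19 ≠ y % 19 :=
  halfDecomposable_of_test (m := 1)
    (L := [(4, [[0, 9, 4, 6], [6, 4, 17, 5], [5, 17, 8, 13]])])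
    (by norm_num) (by norm_num) (by norm_num) (by decide +kernel) (by decide +kernel)

theorem halfDecomposable_22 :
    HalfDecomposable fun x y => x < 22 ∧ y < 22 ∧ x % 22 ≠ y % 22 :=
  halfDecomposable_of_test (m := 2)
    (L := [(0, [[0, 16, 14, 21], [19, 14, 16, 3]]), (2, [[0, 1, 15, 3], [1, 0, 12, 8], [2, 21, 8,
    12], [21, 2, 19, 15], [15, 19, 5, 20]])])
    (by norm_num) (by norm_num) (by norm_num) (by decide +kernel) (by decide +kernel)

theorem halfDecomposable_25 :
    HalfDecomposable fun x y => x < 25 ∧ y < 25 ∧ x % 25 ≠ y % 25 :=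
  halfDecomposable_of_test (m := 1)
    (L := [(0, [[0, 1, 3, 8], [12, 5, 1, 0]]), (0, [[0, 19, 4, 16], [10, 8, 19, 0]])])
    (by norm_num) (by norm_num) (by norm_num) (by decide +kernel) (by decide +kernel)

theorem halfDecomposable_28 :
    HalfDecomposable fun x y => x < 28 ∧ y < 28 ∧ x % 28 ≠ y % 28 :=
  halfDecomposable_of_test (m := 2)
    (L := [(0, [[0, 12, 14, 20], [12, 0, 22, 27]]), (0, [[10, 5, 17, 23], [13, 23, 17, 16]]), (7,
    [[3, 17, 14, 4]]), (0, [[9, 26, 17, 22], [0, 26, 9, 1]]), (0, [[23, 14, 11, 18], [9, 18, 11,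
    7]])])
    (by norm_num) (by norm_num) (by norm_num) (by decide +kernel) (by decide +kernel)

theorem halfDecomposable_31 :
    HalfDecomposable fun x y => x < 31 ∧ y < 31 ∧ x % 31 ≠ y % 31 :=
  halfDecomposable_of_test (m := 1)
    (L := [(3, [[13, 18, 4, 29], [6, 8, 4, 18], [4, 8, 1, 7]]), (0, [[9, 1, 27, 16], [1, 9, 22,
    10]])])
    (by norm_num) (by norm_num) (by norm_num) (by decide +kernel) (by decide +kernel)

theorem halfDecomposable_34 :
    HalfDecomposable fun x y => x < 34 ∧ y < 34 ∧ x % 34 ≠ y % 34 :=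
  halfDecomposable_of_test (m := 2)
    (L := [(0, [[17, 24, 9, 15], [9, 24, 13, 29]]), (0, [[5, 17, 7, 2], [17, 5, 18, 1]]), (0,
    [[9, 30, 26, 23], [26, 30, 25, 18]]), (0, [[4, 13, 7, 18], [13, 4, 16, 2]]), (0, [[22, 4, 6,
    12], [12, 6, 19, 27]]), (12, [[11, 10, 20, 21]])])
    (by norm_num) (by norm_num) (by norm_num) (by decide +kernel) (by decide +kernel)

theorem halfDecomposable_37 :
    HalfDecomposable fun x y => x < 37 ∧ y < 37 ∧ x % 37 ≠ y % 37 :=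
  halfDecomposable_of_test (m := 1)
    (L := [(0, [[6, 7, 15, 9], [10, 15, 7, 25]]), (0, [[17, 34, 8, 24], [13, 8, 34, 1]]), (0,
    [[3, 17, 15, 2], [33, 19, 2, 15]])])
    (by norm_num) (by norm_num) (by norm_num) (by decide +kernel) (by decide +kernel)

theorem halfDecomposable_40 :
    HalfDecomposable fun x y => x < 40 ∧ y < 40 ∧ x % 40 ≠ y % 40 :=
  halfDecomposable_of_test (m := 2)
    (L := [(0, [[30, 38, 28, 1], [38, 30, 2, 16]]), (0, [[29, 0, 10, 34], [0, 29, 28, 35]]), (10,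
    [[39, 8, 9, 29]]), (0, [[26, 9, 13, 2], [30, 7, 9, 26]]), (0, [[4, 19, 37, 13], [15, 13, 37,
    10]]), (0, [[19, 22, 2, 4], [31, 22, 19, 27]]), (0, [[13, 14, 20, 5], [27, 39, 14, 13]])])
    (by norm_num) (by norm_num) (by norm_num) (by decide +kernel) (by decide +kernel)

theorem halfDecomposable_43 :
    HalfDecomposable fun x y => x < 43 ∧ y < 43 ∧ x % 43 ≠ y % 43 :=
  halfDecomposable_of_test (m := 1)
    (L := [(34, [[21, 38, 20, 33], [19, 12, 33, 20], [29, 12, 19, 39], [39, 19, 11, 35], [35, 11,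
    29, 14]]), (0, [[34, 32, 23, 20], [32, 34, 38, 0]])])
    (by norm_num) (by norm_num) (by norm_num) (by decide +kernel) (by decide +kernel)

theorem halfDecomposable_46 :
    HalfDecomposable fun x y => x < 46 ∧ y < 46 ∧ x % 46 ≠ y % 46 :=
  halfDecomposable_of_test (m := 2)
    (L := [(0, [[42, 43, 44, 32], [39, 32, 44, 7]]), (0, [[6, 22, 30, 9], [30, 22, 41, 27]]), (0,
    [[15, 28, 11, 13], [11, 28, 21, 5]]), (0, [[35, 44, 25, 43], [9, 43, 25, 0]]), (0, [[16, 33,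
    44, 30], [26, 44, 33, 39]]), (0, [[12, 32, 42, 38], [15, 44, 38, 42]]), (0, [[29, 33, 7, 2],
    [7, 33, 45, 32]]), (11, [[18, 33, 9, 40]])])
    (by norm_num) (by norm_num) (by norm_num) (by decide +kernel) (by decide +kernel)

theorem halfDecomposable_49 :
    HalfDecomposable fun x y => x < 49 ∧ y < 49 ∧ x % 49 ≠ y % 49 :=
  halfDecomposable_of_test (m := 1)
    (L := [(0, [[33, 47, 32, 9], [32, 47, 39, 11]]), (0, [[6, 28, 26, 15], [37, 28, 6, 38]]), (0,
    [[8, 14, 16, 11], [34, 18, 14, 8]]), (0, [[26, 1, 31, 43], [12, 43, 31, 47]])])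
    (by norm_num) (by norm_num) (by norm_num) (by decide +kernel) (by decide +kernel)

theorem halfDecomposable_52 :
    HalfDecomposable fun x y => x < 52 ∧ y < 52 ∧ x % 52 ≠ y % 52 :=
  halfDecomposable_of_test (m := 2)
    (L := [(0, [[20, 42, 10, 11], [50, 2, 11, 10]]), (0, [[24, 12, 18, 29], [29, 18, 46, 44]]),
    (0, [[44, 30, 22, 29], [29, 22, 5, 38]]), (0, [[40, 37, 22, 3], [1, 37, 40, 35]]), (25, [[23,
    11, 1, 24], [49, 41, 24, 1], [47, 41, 49, 21], [41, 47, 9, 14], [51, 9, 47, 6]]), (0, [[18,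
    2, 43, 20], [40, 20, 43, 7]]), (0, [[45, 40, 36, 15], [22, 15, 36, 46]])])
    (by norm_num) (by norm_num) (by norm_num) (by decide +kernel) (by decide +kernel)

theorem halfDecomposable_55 :
    HalfDecomposable fun x y => x < 55 ∧ y < 55 ∧ x % 55 ≠ y % 55 :=
  halfDecomposable_of_test (m := 1)
    (L := [(0, [[13, 45, 27, 0], [42, 20, 45, 13]]), (31, [[8, 16, 35, 4], [16, 8, 13, 47], [11,
    47, 13, 33]]), (0, [[54, 48, 8, 52], [23, 52, 8, 3]]), (0, [[41, 32, 31, 48], [48, 31, 49,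
    6]])])
    (by norm_num) (by norm_num) (by norm_num) (by decide +kernel) (by decide +kernel)

theorem halfDecomposable_58 :
    HalfDecomposable fun x y => x < 58 ∧ y < 58 ∧ x % 58 ≠ y % 58 :=
  halfDecomposable_of_test (m := 2)
    (L := [(0, [[1, 38, 6, 28], [6, 38, 57, 16]]), (27, [[14, 5, 15, 9], [15, 5, 45, 6], [45, 5,
    11, 7]]), (0, [[53, 11, 8, 42], [42, 8, 29, 22]]), (0, [[48, 15, 51, 27], [18, 51, 15, 1]]),
    (0, [[15, 14, 30, 43], [43, 30, 50, 57]]), (0, [[44, 3, 46, 28], [5, 3, 44, 14]]), (0, [[44,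
    32, 43, 17], [32, 44, 50, 36]]), (0, [[21, 16, 24, 5], [44, 53, 16, 21]]), (0, [[49, 14, 37,
    29], [37, 14, 12, 8]])])
    (by norm_num) (by norm_num) (by norm_num) (by decide +kernel) (by decide +kernel)

theorem halfDecomposable_64 :
    HalfDecomposable fun x y => x < 64 ∧ y < 64 ∧ x % 64 ≠ y % 64 :=
  halfDecomposable_of_test (m := 2)
    (L := [(0, [[59, 11, 36, 6], [16, 36, 11, 10]]), (30, [[12, 18, 26, 63], [45, 63, 26, 14],
    [35, 22, 14, 26]]), (0, [[61, 25, 45, 31], [4, 25, 61, 34]]), (0, [[29, 34, 61, 53], [62, 53,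
    61, 11]]), (0, [[34, 16, 2, 12], [32, 49, 16, 34]]), (0, [[55, 52, 14, 49], [54, 30, 52,
    55]]), (0, [[23, 58, 63, 1], [11, 32, 1, 63]]), (0, [[56, 33, 36, 8], [43, 53, 8, 36]]), (0,
    [[44, 55, 29, 59], [55, 44, 3, 4]]), (0, [[63, 16, 45, 25], [16, 63, 6, 59]])])
    (by norm_num) (by norm_num) (by norm_num) (by decide +kernel) (by decide +kernel)

theorem halfDecomposable_67 :
    HalfDecomposable fun x y => x < 67 ∧ y < 67 ∧ x % 67 ≠ y % 67 :=
  halfDecomposable_of_test (m := 1)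
    (L := [(2, [[37, 28, 44, 2], [17, 14, 2, 44], [63, 2, 14, 40], [2, 63, 61, 33], [33, 61, 57,
    23], [57, 61, 44, 37], [44, 61, 30, 39]]), (0, [[60, 4, 39, 44], [4, 60, 6, 14]]), (0, [[26,
    60, 7, 8], [52, 55, 8, 7]])])
    (by norm_num) (by norm_num) (by norm_num) (by decide +kernel) (by decide +kernel)

end BaseDesigns

section Constructions

variable {α β : Type*}

/-- The complete graph on a finite set of points. -/
def completeOn (X : Finset α) (x y : α) : Prop :=
  x ∈ X ∧ y ∈ X ∧ x ≠ y

theorem halfDecomposable_of_forall_not {R : α → α → Prop} (h : ∀ x y, ¬ R x y) :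
    HalfDecomposable R :=
  ⟨∅, by simp, by simp, fun x y hxy => (h x y hxy).elim, by simp, by simp, by simp⟩

theorem HalfDecomposable.completeOn_of_card_eq {X : Finset α} {Y : Finset β}
    (h : HalfDecomposable (completeOn X)) (hXY : X.card = Y.card) :
    HalfDecomposable (completeOn Y) := by
  rcases Y.eq_empty_or_nonempty with rfl | ⟨y, hy⟩
  · exact halfDecomposable_of_forall_not fun x y hxy => Finset.notMem_empty _ hxy.1
  obtain ⟨x, hx⟩ : X.Nonempty := by
    rw [← Finset.card_pos, hXY, Finset.card_pos]
    exact ⟨y, hy⟩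
  have : Nonempty α := ⟨x⟩
  have : Nonempty β := ⟨y⟩
  obtain ⟨f, hf⟩ := X.finite_toSet.exists_bijOn_of_encard_eq
    (t := (Y : Set β)) (by simpa using hXY)
  have hinv := hf.invOn_invFunOn
  refine h.transport f (Function.invFunOn f X) (s := X) (fun x y hxy => ⟨hxy.1, hxy.2.1⟩)
    hinv.1 fun p q => ⟨?_, ?_⟩
  · rintro ⟨hp, hq, hpq⟩
    obtain ⟨x, hx, rfl⟩ := hf.surjOn hp
    obtain ⟨y, hy, rfl⟩ := hf.surjOn hq
    exact ⟨x, y, ⟨hx, hy, fun h => hpq (by rw [h])⟩, rfl, rfl⟩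
  · rintro ⟨x, y, ⟨hx, hy, hxy⟩, rfl, rfl⟩
    exact ⟨hf.mapsTo hx, hf.mapsTo hy, fun h => hxy (hf.injOn hx hy h)⟩

theorem halfDecomposable_multipartite {I : Type*} {J : Finset I} {k : ℕ} (hk : 0 < k)
    (hJ : J.card = k)
    (h : HalfDecomposable fun x y => x < k * 3 ∧ y < k * 3 ∧ x % k ≠ y % k) :
    HalfDecomposable fun p q : I × Fin 3 => p.1 ∈ J ∧ q.1 ∈ J ∧ p.1 ≠ q.1 := by
  set e := J.equivFinOfCardEq hJ
  have hval : ∀ p : Fin k × Fin 3, (p.1 + k * p.2 : ℕ) % k = p.1 ∧ (p.1 + k * p.2 : ℕ) / k = p.2 :=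
    fun p => ⟨by rw [Nat.add_mul_mod_self_left, Nat.mod_eq_of_lt p.1.2],
      by rw [Nat.add_mul_div_left _ _ hk, Nat.div_eq_of_lt p.1.2, zero_add]⟩
  set f : ℕ → I × Fin 3 := fun n => (e.symm ⟨n % k, Nat.mod_lt _ hk⟩, Fin.ofNat 3 (n / k))
  have hf : ∀ n < k * 3, ((f n).2 : ℕ) = n / k := fun n hn =>
    Nat.mod_eq_of_lt (Nat.div_lt_of_lt_mul hn)
  have hsurj : ∀ p : I × Fin 3, p.1 ∈ J → ∃ n < k * 3, f n = p := by
    rintro ⟨i, z⟩ hi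
    obtain ⟨h1, h2⟩ := hval (e ⟨i, hi⟩, z)
    have hlt := (e ⟨i, hi⟩).2
    have hz := z.2
    refine ⟨e ⟨i, hi⟩ + k * z, by nlinarith, ?_⟩
    ext
    · dsimp only [f]
      simp only [h1]
      simp
    · dsimp only [f]
      rw [h2, Fin.val_ofNat, Nat.mod_eq_of_lt z.2]
  have hmod : ∀ m n, (f m).1 = (f n).1 ↔ m % k = n % k := fun m n => by
    simp only [f, Subtype.coe_inj, EmbeddingLike.apply_eq_iff_eq, Fin.mk.injEq]
  have hinj : Set.InjOn f {n | n < k * 3} := by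
    intro m hm n hn hmn
    have h1 := (hmod m n).1 (by rw [hmn])
    have h2 : m / k = n / k := by rw [← hf m hm, ← hf n hn, hmn]
    rw [← Nat.div_add_mod m k, ← Nat.div_add_mod n k, h1, h2]
  refine h.transport f (Function.invFunOn f {n | n < k * 3}) (s := {n | n < k * 3})
    (fun x y hxy => ⟨hxy.1, hxy.2.1⟩) hinj.leftInvOn_invFunOn fun p q => ⟨?_, ?_⟩
  · rintro ⟨hp, hq, hpq⟩
    obtain ⟨m, hm, rfl⟩ := hsurj p hp
    obtain ⟨n, hn, rfl⟩ := hsurj q hq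
    exact ⟨m, n, ⟨hm, hn, fun h => hpq ((hmod m n).2 h)⟩, rfl, rfl⟩
  · rintro ⟨m, n, ⟨hm, hn, hmn⟩, rfl, rfl⟩
    exact ⟨Subtype.coe_prop _, Subtype.coe_prop _, fun h => hmn ((hmod m n).1 h)⟩

theorem halfDecomposable_multipartite_of_mem {I : Type*} {J : Finset I} (h4 : 4 ≤ J.card)
    (h6 : J.card ≤ 6) :
    HalfDecomposable fun p q : I × Fin 3 => p.1 ∈ J ∧ q.1 ∈ J ∧ p.1 ≠ q.1 := by
  refine halfDecomposable_multipartite (by omega) rfl ?_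
  obtain h | h | h : J.card = 4 ∨ J.card = 5 ∨ J.card = 6 := by omega
  · rw [h]
    exact halfDecomposable_multipartite_four
  · rw [h]
    exact halfDecomposable_multipartite_five
  · rw [h]
    exact halfDecomposable_multipartite_six

/-- The Wilson construction with weight three and one point at infinity, applied to a truncated
transversal design with lines `ℓ l`. -/
theorem halfDecomposable_of_transversal {Λ I K : Type*} [Fintype Λ] [Fintype I]
    (ℓ : Λ → I → K) (hℓ : ∀ i j, i ≠ j → ∀ x y, ∃! l, ℓ l i = x ∧ ℓ l j = y) (A : I → Finset K)
    (hA : ∀ i, HalfDecomposable (completeOn (Finset.range (3 * (A i).card + 1))))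
    (h4 : ∀ l, 4 ≤ (Finset.univ.filter fun i => ℓ l i ∈ A i).card)
    (h6 : ∀ l, (Finset.univ.filter fun i => ℓ l i ∈ A i).card ≤ 6) :
    HalfDecomposable (completeOn (Finset.range (3 * ∑ i, (A i).card + 1))) := by
  set P : I → Finset ((I × K) × Fin 3) := fun i =>
    (({i} : Finset I) ×ˢ A i) ×ˢ Finset.univ with hP
  have hPmem : ∀ i p, p ∈ P i ↔ p.1.1 = i ∧ p.1.2 ∈ A i := fun i p => by
    simp only [hP, Finset.mem_product, Finset.mem_singleton, Finset.mem_univ, and_true]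
  have hPcard : ∀ i, (P i).card = 3 * (A i).card := fun i => by
    simp [hP, mul_comm]
  have hPdisj : ∀ i j, i ≠ j → Disjoint (P i) (P j) := by
    intro i j hij
    rw [Finset.disjoint_left]
    intro p hi hj
    rw [hPmem] at hi hj
    exact hij (hi.1.symm.trans hj.1)
  have hgroup : ∀ i, HalfDecomposable (completeOn (P i).insertNone) := fun i =>
    (hA i).completeOn_of_card_eq (by rw [Finset.card_range, Finset.card_insertNone, hPcard])
  set Q : Λ → Option ((I × K) × Fin 3) → Option ((I × K) × Fin 3) → Prop := fun l p q =>
    ∃ r s, p = some r ∧ q = some s ∧ r.1.2 = ℓ l r.1.1 ∧ s.1.2 = ℓ l s.1.1 ∧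
      r.1.2 ∈ A r.1.1 ∧ s.1.2 ∈ A s.1.1 ∧ r.1.1 ≠ s.1.1 with hQ
  have hline : ∀ l, HalfDecomposable (Q l) := by
    intro l
    refine (halfDecomposable_multipartite_of_mem (h4 l) (h6 l)).transport
      (fun p => some ((p.1, ℓ l p.1), p.2))
      (fun q => q.elim (Classical.choose (Finset.card_pos.1 (lt_of_lt_of_le (by norm_num) (h4 l))),
        0) fun r => (r.1.1, r.2)) (s := Set.univ) (fun _ _ _ => ⟨trivial, trivial⟩)
      (fun _ _ => rfl) fun p q => ⟨?_, ?_⟩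
    · rintro ⟨⟨⟨i, x⟩, z⟩, ⟨⟨j, y⟩, w⟩, rfl, rfl, hx', hy', hx, hy, hij⟩
      dsimp only at hx' hy'
      subst hx' hy'
      exact ⟨(i, z), (j, w), by simpa using ⟨hx, hy, hij⟩, rfl, rfl⟩
    · rintro ⟨⟨i, z⟩, ⟨j, w⟩, ⟨hi, hj, hij⟩, rfl, rfl⟩
      simp only [Finset.mem_filter, Finset.mem_univ, true_and] at hi hj
      exact ⟨_, _, rfl, rfl, rfl, rfl, hi, hj, hij⟩
  have hcard : ((Finset.univ.biUnion P).insertNone).card =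
      (Finset.range (3 * ∑ i, (A i).card + 1)).card := by
    rw [Finset.card_insertNone, Finset.card_range,
      Finset.card_biUnion fun i _ j _ hij => hPdisj i j hij, Finset.mul_sum]
    simp only [hPcard]
  have hmemA : ∀ r, r ∈ Finset.univ.biUnion P ↔ r ∈ P r.1.1 := by
    intro r
    simp only [Finset.mem_biUnion, Finset.mem_univ, true_and, hPmem, exists_eq_left']
  have hone : ∀ i r, some r ∈ (P i).insertNone → r.1.1 = i := fun i r hr =>
    ((hPmem i r).1 (Finset.some_mem_insertNone.1 hr)).1
  have hcross : ∀ l i p q, Q l p q → ¬ completeOn (P i).insertNone p q := by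
    rintro l i p q ⟨r, s, rfl, rfl, -, -, -, -, hrs⟩ ⟨hr, hs, -⟩
    exact hrs ((hone i r hr).trans (hone i s hs).symm)
  refine HalfDecomposable.completeOn_of_card_eq ?_ hcard
  refine HalfDecomposable.iUnion (ι := Λ ⊕ I)
    (Q := Sum.elim Q fun i => completeOn (P i).insertNone) ?_ ?_ ?_ ?_
  · rintro (l | i)
    exacts [hline l, hgroup i]
  · intro p q
    simp only [Sum.exists, Sum.elim_inl, Sum.elim_inr]
    constructor
    · rintro ⟨hp, hq, hpq⟩
      rcases p with _ | r <;> rcases q with _ | s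
      · exact absurd rfl hpq
      · exact Or.inr ⟨s.1.1, by simp, by simpa using (hmemA s).1 (by simpa using hq), hpq⟩
      · exact Or.inr ⟨r.1.1, by simpa using (hmemA r).1 (by simpa using hp), by simp, hpq⟩
      · have hr := (hmemA r).1 (by simpa using hp)
        have hs := (hmemA s).1 (by simpa using hq)
        by_cases hrs : r.1.1 = s.1.1
        · refine Or.inr ⟨r.1.1, ?_, ?_, hpq⟩
          · simpa using hr
          · simpa [hrs] using hs
        · obtain ⟨l, ⟨h1, h2⟩, -⟩ := hℓ _ _ hrs r.1.2 s.1.2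
          exact Or.inl ⟨l, r, s, rfl, rfl, h1.symm, h2.symm, ((hPmem _ _).1 hr).2,
            ((hPmem _ _).1 hs).2, hrs⟩
    · rintro (⟨l, r, s, rfl, rfl, -, -, hr, hs, hrs⟩ | ⟨i, hp, hq, hpq⟩)
      · refine ⟨?_, ?_, fun h => hrs (by rw [Option.some.inj h])⟩
        · simpa using (hmemA r).2 ((hPmem _ _).2 ⟨rfl, hr⟩)
        · simpa using (hmemA s).2 ((hPmem _ _).2 ⟨rfl, hs⟩)
      · have hsub := Finset.insertNone.monotone
          (Finset.subset_biUnion_of_mem P (Finset.mem_univ i))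
        exact ⟨hsub hp, hsub hq, hpq⟩
  · rintro (l | i) p q
    · rintro ⟨r, s, hr, hs, h1, h2, h3, h4, h5⟩
      exact ⟨s, r, hs, hr, h2, h1, h4, h3, h5.symm⟩
    · rintro ⟨hp, hq, hpq⟩
      exact ⟨hq, hp, hpq.symm⟩
  · rintro (l | i) (l' | j) p q h h'
    · obtain ⟨r, s, rfl, rfl, h1, h2, -, -, hrs⟩ := h
      obtain ⟨r', s', hr, hs, h1', h2', -⟩ := h'
      obtain rfl := Option.some.inj hr
      obtain rfl := Option.some.inj hs
      rw [(hℓ _ _ hrs r.1.2 s.1.2).unique ⟨h1.symm, h2.symm⟩ ⟨h1'.symm, h2'.symm⟩]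
    · exact (hcross l j p q h h').elim
    · exact (hcross l' i p q h' h).elim
    · obtain ⟨hp, hq, hpq⟩ := h
      obtain ⟨hp', hq', -⟩ := h'
      congr 1
      rcases p with _ | r
      · rcases q with _ | s
        · exact absurd rfl hpq
        · exact (hone i s hq).symm.trans (hone j s hq')
      · exact (hone i r hp).symm.trans (hone j r hp')

end Constructions

section Recursion

/-- The complete graph on `3 * u + 1` points is half-decomposable. -/
def GoodOrder (u : ℕ) : Prop :=
  HalfDecomposable (completeOn (Finset.range (3 * u + 1)))

theorem goodOrder_zero : GoodOrder 0 := by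
  refine halfDecomposable_of_forall_not fun x y hxy => hxy.2.2 ?_
  have hx := Finset.mem_range.1 hxy.1
  have hy := Finset.mem_range.1 hxy.2.1
  omega

theorem goodOrder_of_mod {u : ℕ}
    (h : HalfDecomposable fun x y => x < 3 * u + 1 ∧ y < 3 * u + 1 ∧
      x % (3 * u + 1) ≠ y % (3 * u + 1)) : GoodOrder u := by
  refine h.transport id id (s := Set.univ) (fun _ _ _ => ⟨trivial, trivial⟩) (fun _ _ => rfl)
    fun p q => ?_
  simp only [completeOn, Finset.mem_range, id, ← and_assoc, exists_eq_right]
  refine and_congr_right fun ⟨hp, hq⟩ => ?_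
  rw [Nat.mod_eq_of_lt hp, Nat.mod_eq_of_lt hq]

/-- The lines of a transversal design over a ring: the slopes `c i` give groups, and the
vertical direction gives one more. -/
theorem goodOrder_of_ring {K : Type*} [CommRing K] [Fintype K] (c : Fin 5 → K)
    (hc : ∀ i j, i ≠ j → IsUnit (c i - c j)) {s t : ℕ} (hs : s ≤ Fintype.card K)
    (ht : t ≤ Fintype.card K) (hK : GoodOrder (Fintype.card K)) (hs' : GoodOrder s)
    (ht' : GoodOrder t) : GoodOrder (4 * Fintype.card K + s + t) := by
  obtain ⟨S, -, hS⟩ := Finset.exists_subset_card_eq (s := (Finset.univ : Finset K)) hs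
  obtain ⟨T, -, hT⟩ := Finset.exists_subset_card_eq (s := (Finset.univ : Finset K)) ht
  set ℓ : K × K → Option (Fin 5) → K := fun l i => i.elim l.2 fun i => l.1 + c i * l.2 with hℓ
  set A : Option (Fin 5) → Finset K := fun i => i.elim T fun i => if i = 4 then S else Finset.univ
    with hA
  have hsum : ∑ i, (A i).card = 4 * Fintype.card K + s + t := by
    rw [Fintype.sum_option, Fin.sum_univ_five]
    simp [hA, hS, hT, Finset.card_univ]
    ring
  rw [← hsum]
  refine halfDecomposable_of_transversal ℓ ?_ A ?_ ?_ ?_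
  · rintro (_ | i) (_ | j) hij x y
    · exact absurd rfl hij
    · refine ⟨(y - c j * x, x), by simp [hℓ], ?_⟩
      rintro ⟨a, b⟩ ⟨h1, h2⟩
      simp only [hℓ, Option.elim] at h1 h2
      rw [← h1, ← h2, add_sub_cancel_right]
    · refine ⟨(x - c i * y, y), by simp [hℓ], ?_⟩
      rintro ⟨a, b⟩ ⟨h1, h2⟩
      simp only [hℓ, Option.elim] at h1 h2
      rw [← h1, ← h2, add_sub_cancel_right]
    · obtain ⟨d, hd⟩ := (hc i j fun h => hij (by rw [h])).exists_right_inv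
      refine ⟨(x - c i * (d * (x - y)), d * (x - y)), ⟨by simp [hℓ], ?_⟩, ?_⟩
      · simp only [hℓ, Option.elim]
        linear_combination (y - x) * hd
      · rintro ⟨a, b⟩ ⟨h1, h2⟩
        simp only [hℓ, Option.elim] at h1 h2
        have hb : b = d * (x - y) := by linear_combination d * h1 - d * h2 - b * hd
        rw [Prod.mk.injEq]
        exact ⟨by rw [← hb, ← h1, add_sub_cancel_right], hb⟩
  · rintro (_ | i)
    · exact hT.symm ▸ ht'
    · by_cases hi : i = 4
      · simp only [hA, Option.elim, hi, if_true, hS]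
        exact hs'
      · simp only [hA, Option.elim, hi, if_false, Finset.card_univ]
        exact hK
  · intro l
    have h4 : ((Finset.univ.erase (4 : Fin 5)).map Function.Embedding.some).card = 4 := by
      rw [Finset.card_map]
      decide
    rw [← h4]
    refine Finset.card_le_card fun i hi => ?_
    obtain ⟨j, hj, rfl⟩ := Finset.mem_map.1 hi
    simp [hA, Finset.ne_of_mem_erase hj]
  · intro l
    exact (Finset.card_le_univ _).trans (by simp)

theorem goodOrder_of_coprime {n s t : ℕ} (hn : n.Coprime 6) (hn5 : 5 ≤ n) (hs : s ≤ n)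
    (ht : t ≤ n) (hK : GoodOrder n) (hs' : GoodOrder s) (ht' : GoodOrder t) :
    GoodOrder (4 * n + s + t) := by
  have : NeZero n := ⟨by omega⟩
  have hsmall : ∀ d : ℕ, 0 < d → d < 5 → IsUnit (d : ZMod n) := by
    intro d h0 h5
    refine (ZMod.isUnit_iff_coprime d n).2 (Nat.Coprime.coprime_dvd_left ?_ (hn.pow_right 2).symm)
    interval_cases d <;> decide
  have h := goodOrder_of_ring (K := ZMod n) (fun i => (i : ℕ)) ?_ (s := s) (t := t)
  · rw [ZMod.card] at h
    exact h hs ht hK hs' ht'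
  · intro i j hij
    rcases lt_or_gt_of_ne (Fin.val_ne_of_ne hij) with h | h
    · rw [← neg_sub, IsUnit.neg_iff, ← Nat.cast_sub h.le]
      exact hsmall _ (by omega) (by omega)
    · rw [← Nat.cast_sub h.le]
      exact hsmall _ (by omega) (by omega)

theorem goodOrder_of_nine {s t : ℕ} (hs : s ≤ 9) (ht : t ≤ 9) (hK : GoodOrder 9)
    (hs' : GoodOrder s) (ht' : GoodOrder t) : GoodOrder (36 + s + t) := by
  have : Fact (Nat.Prime 3) := ⟨Nat.prime_three⟩
  have : Fintype (GaloisField 3 2) := Fintype.ofFinite _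
  have hcard : Fintype.card (GaloisField 3 2) = 9 := by
    rw [Fintype.card_eq_nat_card, GaloisField.card 3 2 (by norm_num)]
    norm_num
  obtain ⟨e⟩ := Function.Embedding.nonempty_of_card_le
    (α := Fin 5) (β := GaloisField 3 2) (by rw [hcard, Fintype.card_fin]; norm_num)
  have h := goodOrder_of_ring e (s := s) (t := t) fun i j hij =>
    (sub_ne_zero.2 fun h => hij (e.injective h)).isUnit
  rw [hcard] at h
  exact h hs ht hK hs' ht'

theorem goodOrder_of_coprime_of_forall {n u : ℕ} (hn : n.Coprime 6) (hn5 : 5 ≤ n)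
    (hgood : ∀ m, 3 ≤ m → m ≤ n → GoodOrder m)
    (hu : u = 4 * n ∨ 4 * n + 3 ≤ u ∧ u ≤ 6 * n) : GoodOrder u := by
  have hK := hgood n (by omega) le_rfl
  obtain rfl | ⟨h1, h2⟩ := hu
  · exact goodOrder_of_coprime hn hn5 (s := 0) (t := 0) (by omega) (by omega) hK goodOrder_zero
      goodOrder_zero
  · by_cases h : u ≤ 5 * n
    · have := goodOrder_of_coprime hn hn5 (s := u - 4 * n) (t := 0) (by omega) (by omega) hK
        (hgood _ (by omega) (by omega)) goodOrder_zero
      rwa [add_zero, Nat.add_sub_cancel' (by omega)] at this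
    · by_cases h3 : u ≤ 5 * n + 2
      · have := goodOrder_of_coprime hn hn5 (s := n - 2) (t := u - (5 * n - 2)) (by omega)
          (by omega) hK (hgood _ (by omega) (by omega)) (hgood _ (by omega) (by omega))
        rwa [show 4 * n + (n - 2) + (u - (5 * n - 2)) = u by omega] at this
      · have := goodOrder_of_coprime hn hn5 (s := n) (t := u - 5 * n) (by omega)
          (by omega) hK hK (hgood _ (by omega) (by omega))
        rwa [show 4 * n + n + (u - 5 * n) = u by omega] at this

theorem goodOrder_of_small {u : ℕ} (h3 : 3 ≤ u) (h : u ≤ 19 ∨ u = 21 ∨ u = 22) :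
    GoodOrder u := by
  apply goodOrder_of_mod
  have hu : u ≤ 22 := by omega
  interval_cases u
  · exact halfDecomposable_10
  · exact halfDecomposable_13
  · exact halfDecomposable_16
  · exact halfDecomposable_19
  · exact halfDecomposable_22
  · exact halfDecomposable_25
  · exact halfDecomposable_28
  · exact halfDecomposable_31
  · exact halfDecomposable_34
  · exact halfDecomposable_37
  · exact halfDecomposable_40
  · exact halfDecomposable_43
  · exact halfDecomposable_46
  · exact halfDecomposable_49
  · exact halfDecomposable_52
  · exact halfDecomposable_55
  · exact halfDecomposable_58
  · exact absurd h (by norm_num)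
  · exact halfDecomposable_64
  · exact halfDecomposable_67

theorem goodOrder {u : ℕ} (hu : 3 ≤ u) : GoodOrder u := by
  induction u using Nat.strong_induction_on with
  | _ u ih =>
    have hstep : ∀ n, n % 6 = 1 ∨ n % 6 = 5 → 5 ≤ n →
        (u = 4 * n ∨ 4 * n + 3 ≤ u ∧ u ≤ 6 * n) → GoodOrder u := by
      intro n hn hn5 h
      refine goodOrder_of_coprime_of_forall ?_ hn5 (fun m hm hmn => ih m (by omega) hm) h
      rw [Nat.Coprime, Nat.gcd_comm, Nat.gcd_rec]
      rcases hn with hn | hn <;> rw [hn] <;> rfl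
    have h9 : ∀ s t, s ≤ 9 → t ≤ 9 → 3 ≤ s → t = 0 ∨ 3 ≤ t → 36 + s + t = u → GoodOrder u := by
      rintro s t hs ht hs3 ht3 rfl
      refine goodOrder_of_nine hs ht (ih _ (by omega) (by norm_num)) (ih _ (by omega) hs3) ?_
      rcases ht3 with rfl | ht3
      exacts [goodOrder_zero, ih _ (by omega) ht3]
    by_cases hsmall : u ≤ 19 ∨ u = 21 ∨ u = 22
    · exact goodOrder_of_small hu hsmall
    by_cases h47 : u < 47
    · by_cases h30 : u = 20 ∨ 23 ≤ u ∧ u ≤ 30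
      · exact hstep 5 (by norm_num) (by norm_num) (by omega)
      by_cases h42 : u ≤ 42
      · exact hstep 7 (by norm_num) (by norm_num) (by omega)
      obtain rfl | rfl | rfl | rfl : u = 43 ∨ u = 44 ∨ u = 45 ∨ u = 46 := by omega
      · exact h9 7 0 (by norm_num) (by norm_num) (by norm_num) (by norm_num) rfl
      · exact hstep 11 (by norm_num) (by norm_num) (by omega)
      · exact h9 9 0 (by norm_num) (by norm_num) (by norm_num) (by norm_num) rfl
      · exact h9 5 5 (by norm_num) (by norm_num) (by norm_num) (by norm_num) rfl
    · obtain ⟨n, hn, h1, h2⟩ : ∃ n, (n % 6 = 1 ∨ n % 6 = 5) ∧ 4 * n + 3 ≤ u ∧ u ≤ 6 * n := by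
        set m := (u - 3) / 4
        obtain h | h | h | h | h : m % 6 = 1 ∨ m % 6 = 5 ∨ (m % 6 = 0 ∨ m % 6 = 2) ∨ m % 6 = 3 ∨
            m % 6 = 4 := by omega
        exacts [⟨m, by omega⟩, ⟨m, by omega⟩, ⟨m - 1, by omega⟩, ⟨m - 2, by omega⟩,
          ⟨m - 3, by omega⟩]
      exact hstep n hn (by omega) (Or.inr ⟨h1, h2⟩)

end Recursion

section DefiningSets

variable {α : Type*}

theorem card_orderedPairs {b : List α} (hb : b.length = 4) : (orderedPairs b).length = 6 := by
  match b, hb with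
  | [_, _, _, _], _ => rfl

theorem nodup_orderedPairs {b : List α} (hb : b.Nodup) : (orderedPairs b).Nodup := by
  induction b with
  | nil => simp [orderedPairs]
  | cons a l ih =>
    rw [List.nodup_cons] at hb
    refine List.Nodup.append (hb.2.map fun x y h => (Prod.mk.inj h).2) (ih hb.2) ?_
    rintro ⟨x, y⟩ hxy hxy'
    obtain ⟨z, -, hz⟩ := List.mem_map.1 hxy
    obtain ⟨rfl, rfl⟩ := Prod.mk.inj hz
    exact hb.1 ((mem_orderedPairs.1 hxy').subset (by simp))

theorem IsHalfDecomposition.six_mul_card [Fintype α] {B : Finset (List α)}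
    (h : IsHalfDecomposition (fun x y : α => x ≠ y) B) :
    6 * B.card = Fintype.card α * (Fintype.card α - 1) := by
  have hcard : ∀ b ∈ B, (orderedPairs b).toFinset.card = 6 := fun b hb => by
    rw [List.toFinset_card_of_nodup (nodup_orderedPairs (h.isBlock b hb).1),
      card_orderedPairs (h.isBlock b hb).2]
  have hunion : (Finset.univ : Finset α).offDiag =
      B.biUnion fun b => (orderedPairs b).toFinset := by
    ext ⟨x, y⟩
    simp only [Finset.mem_offDiag, Finset.mem_univ, true_and, Finset.mem_biUnion,
      List.mem_toFinset, mem_orderedPairs]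
    exact ⟨h.exists_mem x y, fun ⟨b, hb, hxy⟩ => h.rel b hb x y hxy⟩
  have hoff := Finset.offDiag_card (Finset.univ : Finset α)
  rw [hunion, Finset.card_biUnion, Finset.sum_congr rfl hcard, Finset.sum_const, smul_eq_mul,
    Finset.card_univ] at hoff
  · rw [mul_comm, hoff, Nat.mul_sub_one]
  · intro b hb c hc hbc
    rw [Function.onFun, Finset.disjoint_left]
    rintro ⟨x, y⟩ hxb hxc
    rw [List.mem_toFinset, mem_orderedPairs] at hxb hxc
    exact hbc (h.unique b hb c hc x y hxb hxc)

theorem IsHalfDecomposition.isDD {B : Finset (List α)}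
    (h : IsHalfDecomposition (fun x y : α => x ≠ y) B) : IsDD 2 4 1 B.val := by
  refine ⟨h.isBlock, fun s hs hlen => ?_⟩
  obtain ⟨x, y, rfl⟩ := List.length_eq_two.1 hlen
  obtain ⟨b, hb, hxy⟩ := h.exists_mem x y (by simpa using hs)
  have : B.filter (fun c => [x, y] <+ c) = {b} := by
    ext c
    rw [Finset.mem_filter, Finset.mem_singleton]
    exact ⟨fun hc => h.unique c hc.1 b hb x y hc.2 hxy, fun hc => hc ▸ ⟨hb, hxy⟩⟩
  rw [Multiset.countP_eq_card_filter, ← Finset.filter_val, this]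
  rfl

theorem swap_perm (l₁ l₂ : List α) (x y : α) : l₁ ++ x :: y :: l₂ ~ l₁ ++ y :: x :: l₂ :=
  (List.Perm.swap y x l₂).append_left l₁

/-- Swapping two consecutive points changes only the order of these two points. -/
theorem pair_sublist_swap {l₁ l₂ : List α} {x y p q : α}
    (h : ([p, q] : List α) ≠ [x, y]) (hpq : [p, q] <+ l₁ ++ x :: y :: l₂) :
    [p, q] <+ l₁ ++ y :: x :: l₂ := by
  induction l₁ with
  | nil =>
    rw [← mem_orderedPairs] at hpq ⊢
    simp only [List.nil_append, orderedPairs, List.map_cons, List.cons_append, List.mem_cons,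
      List.mem_append] at hpq ⊢
    rcases hpq with h' | h'
    · exact absurd (by rw [(Prod.mk.inj h').1, (Prod.mk.inj h').2]) h
    · tauto
  | cons a l ih =>
    cases hpq with
    | cons _ h' => exact (ih h').cons a
    | cons_cons _ h' =>
      exact List.Sublist.cons_cons _
        (List.singleton_sublist.2 ((swap_perm l l₂ x y).mem_iff.1 (List.singleton_sublist.1 h')))

theorem IsBlock.of_perm {k : ℕ} {b c : List α} (hb : IsBlock k b) (h : b ~ c) : IsBlock k c :=
  ⟨h.nodup_iff.1 hb.1, h.length_eq ▸ hb.2⟩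

theorem not_pair_sublist_of_pair_sublist {b : List α} (hb : b.Nodup) {x y : α}
    (h : [x, y] <+ b) : ¬ [y, x] <+ b := by
  induction b with
  | nil => simp at h
  | cons a l ih =>
    rw [List.nodup_cons] at hb
    intro h'
    cases h with
    | cons _ h =>
      cases h' with
      | cons _ h' => exact ih hb.2 h h'
      | cons_cons _ h' => exact hb.1 (h.subset (by simp))
    | cons_cons _ h =>
      cases h' with
      | cons _ h' => exact hb.1 (h'.subset (by simp))
      | cons_cons _ h' => exact hb.1 (List.singleton_sublist.1 h)

theorem pair_sublist_middle (l₁ l₂ : List α) (x y : α) : [x, y] <+ l₁ ++ x :: y :: l₂ :=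
  (List.IsInfix.sublist ⟨l₁, l₂, by simp⟩ : [x, y] <+ l₁ ++ x :: y :: l₂)

/-- A defining set meets every volume-two trade. -/
theorem IsHalfDecomposition.meetsSwaps {B : Finset (List α)}
    (h : IsHalfDecomposition (fun x y : α => x ≠ y) B) {S : Finset (List α)}
    (hS : IsDefiningSet 2 4 1 B.val S.val) : MeetsSwaps B S := by
  rintro b hb c hc ⟨x, y, ⟨l₁, l₂, hbl⟩, ⟨m₁, m₂, hcl⟩⟩
  rw [List.append_assoc, List.cons_append, List.cons_append, List.nil_append] at hbl hcl
  by_contra! hbcS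
  obtain ⟨hbS, hcS⟩ := hbcS
  have hbB := h.isBlock b hb
  have hcB := h.isBlock c hc
  have hbxy : [x, y] <+ b := hbl ▸ pair_sublist_middle _ _ _ _
  have hcyx : [y, x] <+ c := hcl ▸ pair_sublist_middle _ _ _ _
  have hbc : b ≠ c := fun hbc => not_pair_sublist_of_pair_sublist hbB.1 hbxy (hbc ▸ hcyx)
  set b' := l₁ ++ y :: x :: l₂ with hb'
  set c' := m₁ ++ x :: y :: m₂ with hc'
  have hbb' : b ~ b' := hbl ▸ swap_perm _ _ _ _
  have hcc' : c ~ c' := hcl ▸ swap_perm _ _ _ _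
  have hb'yx : [y, x] <+ b' := pair_sublist_middle _ _ _ _
  have hc'xy : [x, y] <+ c' := pair_sublist_middle _ _ _ _
  have hb'xy := not_pair_sublist_of_pair_sublist (hbB.of_perm hbb').1 hb'yx
  have hc'yx := not_pair_sublist_of_pair_sublist (hcB.of_perm hcc').1 hc'xy
  have hbyx := not_pair_sublist_of_pair_sublist hbB.1 hbxy
  have hcxy := not_pair_sublist_of_pair_sublist hcB.1 hcyx
  have hpair : ∀ p q : α, ([p, q] : List α) ≠ [x, y] → [p, q] ≠ [y, x] →
      (([p, q] <+ b' ↔ [p, q] <+ b) ∧ ([p, q] <+ c' ↔ [p, q] <+ c)) := by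
    intro p q hxy hyx
    rw [← hbl, ← hcl]
    exact ⟨⟨pair_sublist_swap hyx, pair_sublist_swap hxy⟩,
      ⟨pair_sublist_swap hxy, pair_sublist_swap hyx⟩⟩
  set R := (B.erase b).erase c with hR
  have hBval : B.val = b ::ₘ c ::ₘ R.val := by
    rw [hR, Finset.erase_val, Finset.erase_val, Multiset.cons_erase, Multiset.cons_erase hb]
    exact (Multiset.mem_erase_of_ne hbc.symm).2 hc
  have hDD := h.isDD
  have hne : b' ∉ B := by
    intro hmem
    have hbne : b ≠ b' := fun hbb => hb'xy (hbb ▸ hbxy)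
    have hle := h.superSimple b hb b' hmem hbne
    rw [← List.toFinset_eq_of_perm _ _ hbb', Finset.inter_self,
      List.toFinset_card_of_nodup hbB.1, hbB.2] at hle
    omega
  have heq := hS.2 (b' ::ₘ c' ::ₘ R.val) ⟨?_, ?_⟩ ?_
  · exact hne (Finset.mem_def.2 (heq ▸ Multiset.mem_cons_self _ _))
  · intro d hd
    rcases Multiset.mem_cons.1 hd with rfl | hd
    · exact hbB.of_perm hbb'
    rcases Multiset.mem_cons.1 hd with rfl | hd
    · exact hcB.of_perm hcc'
    · exact h.isBlock d (Finset.mem_of_mem_erase (Finset.mem_of_mem_erase hd))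
  · intro s hs hlen
    rw [← hDD.2 s hs hlen, hBval]
    obtain ⟨p, q, rfl⟩ := List.length_eq_two.1 hlen
    simp only [Multiset.countP_cons]
    by_cases hxy : [p, q] = [x, y]
    · simp only [hxy, hbxy, hcxy, hb'xy, hc'xy]
      simp
    by_cases hyx : [p, q] = [y, x]
    · simp only [hyx, hbyx, hcyx, hb'yx, hc'yx]
      simp
    · simp only [hpair p q hxy hyx]
  · refine le_trans ?_ ((Multiset.le_cons_self _ c').trans (Multiset.le_cons_self _ b'))
    rw [Finset.val_le_iff]
    intro d hd
    refine Finset.mem_erase.2 ⟨fun h => hcS (h ▸ hd), Finset.mem_erase.2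
      ⟨fun h => hbS (h ▸ hd), ?_⟩⟩
    exact Multiset.mem_of_le hS.1 hd

end DefiningSets

/-- For every `v ≥ 10` with `v ≡ 1 (mod 3)` there is a
super-simple `2-(v,4,1)DD` (with `v(v-1)/6` blocks) whose every defining set
contains at least half of the blocks, i.e. at least `v(v-1)/12` blocks. -/
theorem stmt6 (v : ℕ) (hv : 10 ≤ v) (hmod : v % 3 = 1) :
    ∃ B : Multiset (List (Fin v)),
      IsDD 2 4 1 B ∧ SuperSimple B ∧
      (Multiset.card B : ℝ) = (v : ℝ) * ((v : ℝ) - 1) / 6 ∧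
      ∀ S : Multiset (List (Fin v)), IsDefiningSet 2 4 1 B S →
        (v : ℝ) * ((v : ℝ) - 1) / 12 ≤ (Multiset.card S : ℝ) := by
  have hu : GoodOrder (v / 3) := goodOrder (by omega)
  obtain ⟨B, hB⟩ := hu.completeOn_of_card_eq (Y := (Finset.univ : Finset (Fin v)))
    (by rw [Finset.card_range, Finset.card_univ, Fintype.card_fin]; omega)
  replace hB : IsHalfDecomposition (fun x y : Fin v => x ≠ y) B := by
    rwa [show completeOn Finset.univ = fun x y : Fin v => x ≠ y by ext; simp [completeOn]] at hB
  have hcard : (6 : ℝ) * B.card = v * (v - 1) := by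
    have := hB.six_mul_card
    rw [Fintype.card_fin] at this
    rw [← Nat.cast_pred (by omega)]
    exact_mod_cast this
  refine ⟨B.val, hB.isDD, fun b c hbc => ?_, ?_, fun S hS => ?_⟩
  · have hnodup := Multiset.nodup_of_le hbc B.nodup
    refine hB.superSimple b (Multiset.mem_of_le hbc (by simp)) c
      (Multiset.mem_of_le hbc (by simp)) ?_
    rintro rfl
    simp at hnodup
  · rw [Finset.card_val]
    linarith
  · obtain ⟨S, rfl⟩ : ∃ T : Finset _, T.val = S := ⟨⟨S, Multiset.nodup_of_le hS.1 B.nodup⟩, rfl⟩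
    have h := hB.half S (Finset.val_le_iff.1 hS.1) (hB.meetsSwaps hS)
    rw [Finset.card_val]
    have h' : (B.card : ℝ) ≤ 2 * S.card := by exact_mod_cast h
    linarith
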